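/- Let n ≥ 1, T > 0, and let H : ℝ^{2n} → ℝ be a C² convex function that is (a∞, b∞)-subquadratic at infinity for real constants a∞ ≤ b∞. Suppose the set of equilibria {ξ : ∇H(ξ) = 0} is a finite nonempty set {ξ₁, …, ξ_N}; for each k let ω_k be the smallest eigenvalue of the Hessian matrix H''(ξ_k), and set ω := min{ω₁, …, ω_N}. If (T/2π) b∞ < −E[−(T/2π) a∞] < (T/2π) ω, where E[α] denotes the unique integer a with a < α ≤ a + 1, then there exists a non-constant C¹ T-periodic solution x̄ : ℝ → ℝ^{2n} of the Hamiltonian system ẋ = J ∇H(x). -/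

import Mathlib

open scoped RealInnerProductSpace
open Real Filter

/-- The standard `2n × 2n` symplectic matrix `J = [[0, Iₙ], [-Iₙ, 0]]`. -/
noncomputable def symplecticJ (n : ℕ) : Matrix (Fin (2*n)) (Fin (2*n)) ℝ :=
  Matrix.reindex (finSumFinEquiv.trans (finCongr (two_mul n).symm))
    (finSumFinEquiv.trans (finCongr (two_mul n).symm))
    (Matrix.fromBlocks 0 1 (-1) 0)

/-- The Hessian matrix of `H : ℝ^m → ℝ` at `ξ`, with entries the second derivatives in the
coordinate directions. -/
noncomputable def hessianMatrix {m : ℕ} (H : EuclideanSpace ℝ (Fin m) → ℝ)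
    (ξ : EuclideanSpace ℝ (Fin m)) : Matrix (Fin m) (Fin m) ℝ :=
  Matrix.of fun i j =>
    iteratedFDeriv ℝ 2 H ξ ![EuclideanSpace.single i 1, EuclideanSpace.single j 1]


theorem aux_saddle {Y Z : Type*} [NormedAddCommGroup Y] [NormedSpace ℝ Y] [FiniteDimensional ℝ Y]
    [NormedAddCommGroup Z] [NormedSpace ℝ Z] [FiniteDimensional ℝ Z]
    (φ : Y → Z → ℝ) (hc : Continuous fun p : Y × Z => φ p.1 p.2)
    (hs : ∀ z y₁ y₂, y₁ ≠ y₂ → ∃ y, min (φ y₁ z) (φ y₂ z) < φ y z)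
    (hb : ∀ R c : ℝ, ∃ B : ℝ, ∀ y z, ‖z‖ ≤ R → c ≤ φ y z → ‖y‖ ≤ B)
    (hz : ∀ c : ℝ, ∃ B : ℝ, ∀ z, φ 0 z ≤ c → ‖z‖ ≤ B) :
    ∃ y₀ z₀, (∀ y, φ y z₀ ≤ φ y₀ z₀) ∧ (∀ z, ∃ y, φ y₀ z₀ ≤ φ y z) ∧
      ∀ (w : Z) (D : Y → ℝ) (C : ℝ), Continuous D →
        (∀ y, ∀ t : ℝ, 0 < t → t ≤ 1 → φ y (z₀ + t • w) ≤ φ y z₀ + t * D y + C * t ^ 2) →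
        0 ≤ D y₀ := by
  have : ProperSpace Y := FiniteDimensional.proper ℝ Y
  have : ProperSpace Z := FiniteDimensional.proper ℝ Z
  have hc1 : ∀ z, Continuous fun y => φ y z := fun z =>
    hc.comp (Continuous.prodMk continuous_id continuous_const)
  have hc2 : ∀ y, Continuous fun z => φ y z := fun y =>
    hc.comp (Continuous.prodMk continuous_const continuous_id)
  have hmax : ∀ z, ∃ y, ∀ y', φ y' z ≤ φ y z := by
    intro z
    obtain ⟨B, hB⟩ := hb ‖z‖ (φ 0 z)
    have hcomp : IsCompact (Metric.closedBall (0 : Y) (max B 0)) := isCompact_closedBall _ _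
    obtain ⟨y, hy, hym⟩ := hcomp.exists_isMaxOn ⟨0, by simp⟩ (hc1 z).continuousOn
    refine ⟨y, fun y' => ?_⟩
    by_cases h : φ 0 z ≤ φ y' z
    · apply hym
      simp only [Metric.mem_closedBall, dist_zero_right]
      exact (hB y' z le_rfl h).trans (le_max_left _ _)
    · have : φ 0 z ≤ φ y z := hym (by simp)
      linarith
  choose ym hym using hmax
  have hlsc : LowerSemicontinuous (fun z => φ (ym z) z) := by
    intro z c hcz
    have : ∀ᶠ z' in nhds z, c < φ (ym z) z' := (hc2 (ym z)).continuousAt.eventually (lt_mem_nhds hcz)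
    filter_upwards [this] with z' hz'
    exact hz'.trans_le (hym z' _)
  obtain ⟨B, hB⟩ := hz (φ (ym 0) 0)
  obtain ⟨z₀, -, hz₀⟩ := (hlsc.lowerSemicontinuousOn (Metric.closedBall (0 : Z) (max B 0))).exists_isMinOn
    ⟨0, by simp⟩ (isCompact_closedBall _ _)
  have hmin : ∀ z, φ (ym z₀) z₀ ≤ φ (ym z) z := by
    intro z
    by_cases h : φ 0 z ≤ φ (ym 0) 0
    · apply hz₀
      simp only [Metric.mem_closedBall, dist_zero_right]
      exact (hB z h).trans (le_max_left _ _)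
    · have h1 : φ (ym z₀) z₀ ≤ φ (ym 0) 0 := hz₀ (by simp)
      have := hym z 0
      linarith
  refine ⟨ym z₀, z₀, hym z₀, fun z => ⟨ym z, hmin z⟩, ?_⟩
  intro w D C hD hexp
  set t : ℕ → ℝ := fun j => 1 / ((j : ℝ) + 1) with ht
  have htt : Tendsto t atTop (nhds 0) := tendsto_one_div_add_atTop_nhds_zero_nat
  have ht0 : ∀ j, 0 < t j := fun j => by positivity
  have ht1 : ∀ j, t j ≤ 1 := fun j => by
    rw [ht]; simp only
    rw [div_le_one (by positivity)]
    have : (0 : ℝ) ≤ j := Nat.cast_nonneg j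
    linarith
  set y : ℕ → Y := fun j => ym (z₀ + t j • w) with hy
  obtain ⟨B', hB'⟩ := hb (‖z₀‖ + ‖w‖) (φ (ym z₀) z₀)
  have hyB : ∀ j, y j ∈ Metric.closedBall (0 : Y) B' := by
    intro j
    simp only [Metric.mem_closedBall, dist_zero_right]
    apply hB' _ (z₀ + t j • w) _ (hmin _)
    refine (norm_add_le _ _).trans ?_
    rw [norm_smul, Real.norm_eq_abs, abs_of_pos (ht0 j)]
    have := mul_le_of_le_one_left (norm_nonneg w) (ht1 j)
    linarith
  obtain ⟨y', -, s, hsm, hst⟩ := (isCompact_closedBall (0 : Y) B').tendsto_subseq hyB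
  have hts : Tendsto (t ∘ s) atTop (nhds 0) := htt.comp hsm.tendsto_atTop
  have hlim : φ (ym z₀) z₀ ≤ φ y' z₀ := by
    have h1 : Tendsto (fun j => φ (y (s j)) (z₀ + t (s j) • w)) atTop (nhds (φ y' z₀)) := by
      have h2 : Tendsto (fun j => (y (s j), z₀ + t (s j) • w)) atTop (nhds (y', z₀)) := by
        apply Tendsto.prodMk_nhds hst
        have := (hts.smul_const w).const_add z₀
        simpa using this
      exact (hc.tendsto (y', z₀)).comp h2
    exact ge_of_tendsto' h1 (fun j => hmin _)
  have hyy : y' = ym z₀ := by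
    by_contra hne
    obtain ⟨y'', hy''⟩ := hs z₀ y' (ym z₀) hne
    rw [min_eq_right hlim] at hy''
    exact absurd (hym z₀ y'') (not_le.mpr hy'')
  have hfin : ∀ j, 0 ≤ D (y (s j)) + C * t (s j) := by
    intro j
    have h1 := hmin (z₀ + t (s j) • w)
    have h2 := hexp (y (s j)) (t (s j)) (ht0 _) (ht1 _)
    have h3 := hym z₀ (y (s j))
    have h4 : 0 ≤ t (s j) * (D (y (s j)) + C * t (s j)) := by
      have h5 : φ (y (s j)) (z₀ + t (s j) • w) = φ (ym (z₀ + t (s j) • w)) (z₀ + t (s j) • w) := rfl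
      nlinarith
    exact nonneg_of_mul_nonneg_right h4 (ht0 _)
  have hl : Tendsto (fun j => D (y (s j)) + C * t (s j)) atTop (nhds (D (ym z₀) + C * 0)) := by
    rw [← hyy]
    exact ((hD.tendsto y').comp hst).add (hts.const_mul C)
  have := ge_of_tendsto' hl hfin
  simpa using this

theorem aux_fourier_real (h : ℝ → ℝ) (hc : Continuous h) (hp : ∀ t, h (t + 2 * π) = h t)
    (h1 : ∀ m : ℤ, ∫ t in (0 : ℝ)..(2 * π), cos (m * t) * h t = 0)
    (h2 : ∀ m : ℤ, ∫ t in (0 : ℝ)..(2 * π), sin (m * t) * h t = 0) : ∀ t, h t = 0 := by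
  have : Fact (0 < 2 * π) := ⟨by positivity⟩
  have hp' : Function.Periodic (fun t => (h t : ℂ)) (2 * π) := fun t => by simp [hp t]
  have hcl : Continuous hp'.lift := by
    apply continuous_coinduced_dom.mpr
    exact Complex.continuous_ofReal.comp hc
  let F : C(AddCircle (2 * π), ℂ) := ⟨hp'.lift, hcl⟩
  have hF : ∀ t : ℝ, F (t : AddCircle (2 * π)) = (h t : ℂ) := fun t => hp'.lift_coe t
  have hco : ∀ m : ℤ, fourierCoeff F m = 0 := by
    intro m
    rw [fourierCoeff_eq_intervalIntegral F m 0, zero_add]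
    have : (∫ x in (0 : ℝ)..(2 * π), @fourier (2 * π) (-m) x • F x)
        = ∫ x in (0 : ℝ)..(2 * π), (((cos (m * x) * h x : ℝ) : ℂ) - Complex.I * ((sin (m * x) * h x : ℝ) : ℂ)) := by
      apply intervalIntegral.integral_congr
      intro x _
      simp only [hF, fourier_coe_apply, smul_eq_mul]
      have e1 : (2 * (π : ℂ) * Complex.I * ((-m : ℤ) : ℂ) * (x : ℂ) / ((2 * π : ℝ) : ℂ))
          = ((-(m * x) : ℝ) : ℂ) * Complex.I := by
        have : (π : ℂ) ≠ 0 := by exact_mod_cast pi_ne_zero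
        push_cast
        field_simp
      rw [e1, Complex.exp_mul_I, ← Complex.ofReal_cos, ← Complex.ofReal_sin, cos_neg, sin_neg]
      push_cast
      ring
    rw [this, intervalIntegral.integral_sub, intervalIntegral.integral_const_mul,
      intervalIntegral.integral_ofReal, intervalIntegral.integral_ofReal, h1, h2]
    · simp
    · apply Continuous.intervalIntegrable; fun_prop
    · apply Continuous.intervalIntegrable; fun_prop
  intro t
  have hs : Summable (fourierCoeff F) := by
    have : fourierCoeff F = fun _ => 0 := funext hco
    rw [this]; exact summable_zero
  have := has_pointwise_sum_fourier_series_of_summable hs (t : AddCircle (2 * π))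
  simp only [hco, zero_smul, hF] at this
  have h0 := this.unique hasSum_zero
  exact_mod_cast h0

section rot
variable {E : Type*} [NormedAddCommGroup E] [InnerProductSpace ℝ E]

/-- rotation -/
noncomputable def auxR (J : E →L[ℝ] E) (s : ℝ) (v : E) : E := cos s • v + sin s • J v

theorem auxR_add (J : E →L[ℝ] E) (s : ℝ) (u v : E) : auxR J s (u + v) = auxR J s u + auxR J s v := by
  simp only [auxR, map_add, smul_add]; abel

theorem auxR_smul (J : E →L[ℝ] E) (s r : ℝ) (u : E) : auxR J s (r • u) = r • auxR J s u := by
  simp only [auxR, map_smul, smul_add, smul_comm r]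

theorem auxR_zero (J : E →L[ℝ] E) (s : ℝ) : auxR J s 0 = 0 := by
  simp [auxR]

theorem auxR_at_zero (J : E →L[ℝ] E) (v : E) : auxR J 0 v = v := by
  simp [auxR]

theorem auxR_continuous (J : E →L[ℝ] E) : Continuous fun p : ℝ × E => auxR J p.1 p.2 := by
  unfold auxR; fun_prop

theorem auxR_inner (J : E →L[ℝ] E) (hJ2 : ∀ v, J (J v) = -v) (hJs : ∀ u v : E, ⟪J u, v⟫ = -⟪u, J v⟫)
    (s t : ℝ) (u v : E) :
    ⟪auxR J s u, auxR J t v⟫ = cos (t - s) * ⟪u, v⟫ + sin (t - s) * ⟪u, J v⟫ := by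
  simp only [auxR, inner_add_left, inner_add_right, inner_smul_left, inner_smul_right, hJs, hJ2,
    inner_neg_right, cos_sub, sin_sub]
  simp
  ring

theorem auxR_norm (J : E →L[ℝ] E) (hJ2 : ∀ v, J (J v) = -v) (hJs : ∀ u v : E, ⟪J u, v⟫ = -⟪u, J v⟫)
    (s : ℝ) (u : E) : ‖auxR J s u‖ = ‖u‖ := by
  have h := auxR_inner J hJ2 hJs s s u u
  simp only [sub_self, cos_zero, sin_zero, real_inner_self_eq_norm_sq] at h
  have h' : ‖auxR J s u‖ ^ 2 = ‖u‖ ^ 2 := by linarith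
  exact (sq_eq_sq₀ (norm_nonneg _) (norm_nonneg _)).mp h'

theorem auxR_hasDerivAt (J : E →L[ℝ] E) (hJ2 : ∀ v, J (J v) = -v) (m t : ℝ) (e : E) :
    HasDerivAt (fun t => auxR J (m * t) e) (m • auxR J (m * t) (J e)) t := by
  have hm : HasDerivAt (fun t : ℝ => m * t) m t := by
    simpa using (hasDerivAt_id t).const_mul m
  have h1 := (hm.cos.smul_const e).add (hm.sin.smul_const (J e))
  refine h1.congr_deriv ?_
  simp only [auxR, hJ2]
  module

theorem aux_int_cos (m : ℤ) (hm : m ≠ 0) : ∫ t in (0 : ℝ)..(2 * π), cos (m * t) = 0 := by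
  have : (m : ℝ) ≠ 0 := by exact_mod_cast hm
  rw [intervalIntegral.integral_comp_mul_left (fun x => cos x) this]
  simp only [integral_cos, mul_zero, sin_zero, sub_zero]
  have : sin ((m : ℝ) * (2 * π)) = 0 := by
    have := Real.sin_int_mul_pi (2 * m)
    push_cast at this
    rw [← this]; ring_nf
  simp [this]

theorem aux_int_sin (m : ℤ) : ∫ t in (0 : ℝ)..(2 * π), sin (m * t) = 0 := by
  by_cases hm : m = 0
  · simp [hm]
  have : (m : ℝ) ≠ 0 := by exact_mod_cast hm
  rw [intervalIntegral.integral_comp_mul_left (fun x => sin x) this]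
  simp only [integral_sin, mul_zero, cos_zero]
  rw [Real.cos_int_mul_two_pi]
  simp

theorem auxR_periodic (J : E →L[ℝ] E) (m : ℤ) (t : ℝ) (e : E) :
    auxR J (m * (t + 2 * π)) e = auxR J (m * t) e := by
  simp only [auxR, mul_add, Real.cos_add_int_mul_two_pi, Real.sin_add_int_mul_two_pi]

theorem auxR_integral (J : E →L[ℝ] E) (hJ2 : ∀ v, J (J v) = -v) (hJs : ∀ u v : E, ⟪J u, v⟫ = -⟪u, J v⟫)
    (m l : ℤ) (u v : E) : ∫ t in (0 : ℝ)..(2 * π), ⟪auxR J (m * t) u, auxR J (l * t) v⟫ =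
      if m = l then 2 * π * ⟪u, v⟫ else 0 := by
  simp only [auxR_inner J hJ2 hJs, ← sub_mul]
  rw [intervalIntegral.integral_add, intervalIntegral.integral_mul_const,
    intervalIntegral.integral_mul_const]
  · have hs := aux_int_sin (l - m)
    push_cast at hs
    rw [hs]
    split_ifs with h
    · subst h; simp
    · have hc := aux_int_cos (l - m) (by omega)
      push_cast at hc
      rw [hc]; simp
  · apply Continuous.intervalIntegrable; fun_prop
  · apply Continuous.intervalIntegrable; fun_prop

theorem aux_fourier_vec (J : E →L[ℝ] E) (hJ2 : ∀ v, J (J v) = -v)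
    (g : ℝ → E) (hc : Continuous g) (hp : ∀ t, g (t + 2 * π) = g t)
    (h : ∀ (m : ℤ) (e : E), ∫ t in (0 : ℝ)..(2 * π), ⟪g t, auxR J (m * t) e⟫ = 0) : ∀ t, g t = 0 := by
  have hR : ∀ e (m : ℤ), Continuous fun t : ℝ => auxR J (m * t) e := fun e m => by
    unfold auxR; fun_prop
  have hi : ∀ e (m : ℤ), IntervalIntegrable (fun t : ℝ => ⟪g t, auxR J (m * t) e⟫) MeasureTheory.volume 0 (2 * π) :=
    fun e m => (hc.inner (hR e m)).intervalIntegrable _ _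
  have key : ∀ v, ∀ t, ⟪g t, v⟫ = 0 := by
    intro v
    apply aux_fourier_real
    · fun_prop
    · intro t; rw [hp]
    · intro m
      have e1 := h m v
      have e2 := h (-m) v
      have e3 : ∫ t in (0 : ℝ)..(2 * π), (⟪g t, auxR J (m * t) v⟫ + ⟪g t, auxR J ((-m : ℤ) * t) v⟫) = 0 := by
        rw [intervalIntegral.integral_add (hi _ _) (hi _ _), e1, e2, add_zero]
      have e4 : ∫ t in (0 : ℝ)..(2 * π), 2 * (cos (m * t) * ⟪g t, v⟫) = 0 := by
        refine Eq.trans ?_ e3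
        apply intervalIntegral.integral_congr
        intro t _
        simp only [auxR, inner_add_right, inner_smul_right]
        push_cast
        rw [neg_mul, cos_neg, sin_neg]; ring
      rw [intervalIntegral.integral_const_mul] at e4
      linarith
    · intro m
      have e1 := h m (-J v)
      have e2 := h (-m) (-J v)
      have e3 : ∫ t in (0 : ℝ)..(2 * π), (⟪g t, auxR J (m * t) (-J v)⟫ - ⟪g t, auxR J ((-m : ℤ) * t) (-J v)⟫) = 0 := by
        rw [intervalIntegral.integral_sub (hi _ _) (hi _ _), e1, e2, sub_zero]
      have e4 : ∫ t in (0 : ℝ)..(2 * π), 2 * (sin (m * t) * ⟪g t, v⟫) = 0 := by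
        refine Eq.trans ?_ e3
        apply intervalIntegral.integral_congr
        intro t _
        simp only [auxR, inner_add_right, inner_smul_right, map_neg, hJ2, neg_neg]
        push_cast
        rw [neg_mul, cos_neg, sin_neg]; ring
      rw [intervalIntegral.integral_const_mul] at e4
      linarith
  intro t
  exact inner_self_eq_zero.mp (key (g t) t)

theorem aux_integral_inner [CompleteSpace E] (e : E) {g : ℝ → E} (hg : Continuous g) {p q : ℝ} :
    ∫ t in p..q, ⟪e, g t⟫ = ⟪e, ∫ t in p..q, g t⟫ := by
  have := ContinuousLinearMap.intervalIntegral_comp_comm (innerSL ℝ e) (hg.intervalIntegrable (μ := MeasureTheory.volume) p q)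
  simpa using this

/-- A continuous function satisfying the equation in Fourier coefficients solves the ODE. -/
theorem aux_weak_solution [CompleteSpace E] (J : E →L[ℝ] E) (hJ2 : ∀ v, J (J v) = -v)
    (hJs : ∀ u v : E, ⟪J u, v⟫ = -⟪u, J v⟫)
    (x g : ℝ → E) (hx : Continuous x) (hg : Continuous g) (hxp : ∀ t, x (t + 2 * π) = x t)
    (hgp : ∀ t, g (t + 2 * π) = g t)
    (h : ∀ (m : ℤ) (e : E), ∫ t in (0 : ℝ)..(2 * π), ⟪g t, auxR J (m * t) e⟫
      = m * ∫ t in (0 : ℝ)..(2 * π), ⟪x t, auxR J (m * t) e⟫) :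
    ∀ t, HasDerivAt x (J (g t)) t := by
  have hR : ∀ e (m : ℤ), Continuous fun t : ℝ => auxR J (m * t) e := fun e m => by
    unfold auxR; fun_prop
  have hJg : Continuous fun t => J (g t) := by fun_prop
  set G : ℝ → E := fun t => ∫ s in (0 : ℝ)..t, J (g s) with hG
  have hGd : ∀ t, HasDerivAt G (J (g t)) t := fun t =>
    intervalIntegral.integral_hasDerivAt_right (hJg.intervalIntegrable _ _)
      hJg.stronglyMeasurable.stronglyMeasurableAtFilter hJg.continuousAt
  have hGc : Continuous G := continuous_iff_continuousAt.mpr fun t => (hGd t).continuousAt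
  have hg0 : ∫ s in (0 : ℝ)..(2 * π), g s = 0 := by
    apply ext_inner_right ℝ
    intro e
    have := h 0 e
    simp only [Int.cast_zero, zero_mul, auxR_at_zero] at this
    rw [inner_zero_left, real_inner_comm, ← aux_integral_inner e hg]
    simpa only [real_inner_comm] using this
  have hG2 : G (2 * π) = 0 := by
    simp only [hG]
    rw [ContinuousLinearMap.intervalIntegral_comp_comm _ (hg.intervalIntegrable _ _), hg0, map_zero]
  have hGp : ∀ t, G (t + 2 * π) = G t := by
    intro t
    have e1 : G (t + 2 * π) - G t = ∫ s in t..(t + 2 * π), J (g s) := by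
      simp only [hG]
      rw [intervalIntegral.integral_interval_sub_left] <;> exact hJg.intervalIntegrable _ _
    have hper : Function.Periodic (fun s => J (g s)) (2 * π) := fun s => by simp only [hgp]
    have e2 := hper.intervalIntegral_add_eq t 0
    rw [zero_add] at e2
    rw [e2] at e1
    have : G (t + 2 * π) - G t = 0 := e1.trans hG2
    exact sub_eq_zero.mp this
  have hparts : ∀ (m : ℤ) (e : E), ∫ t in (0 : ℝ)..(2 * π), ⟪g t, auxR J (m * t) e⟫
      = m * ∫ t in (0 : ℝ)..(2 * π), ⟪G t, auxR J (m * t) e⟫ := by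
    intro m e
    have hd : ∀ t ∈ Set.uIcc (0 : ℝ) (2 * π), HasDerivAt (fun t => ⟪G t, auxR J (m * t) (-J e)⟫)
        (m * ⟪G t, auxR J (m * t) e⟫ - ⟪g t, auxR J (m * t) e⟫) t := by
      intro t _
      have := (hGd t).inner ℝ (auxR_hasDerivAt J hJ2 m t (-J e))
      refine this.congr_deriv ?_
      rw [map_neg, hJ2, neg_neg, inner_smul_right, hJs]
      have : J (auxR J (m * t) (-J e)) = auxR J (m * t) e := by
        simp only [auxR, map_add, map_smul, map_neg, hJ2, neg_neg]
      rw [this]; ring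
    have hci : Continuous fun t : ℝ => (m * ⟪G t, auxR J (m * t) e⟫ - ⟪g t, auxR J (m * t) e⟫ : ℝ) :=
      (continuous_const.mul (hGc.inner (hR e m))).sub (hg.inner (hR e m))
    have := intervalIntegral.integral_eq_sub_of_hasDerivAt hd (hci.intervalIntegrable _ _)
    rw [intervalIntegral.integral_sub ((continuous_const.mul (hGc.inner (hR e m))).intervalIntegrable _ _)
      ((hg.inner (hR e m)).intervalIntegrable _ _), intervalIntegral.integral_const_mul, hG2] at this
    have hG0 : G 0 = 0 := by simp [hG]
    rw [hG0, inner_zero_left, inner_zero_left] at this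
    linarith
  set A : E := (2 * π)⁻¹ • ∫ t in (0 : ℝ)..(2 * π), (x t - G t) with hA
  have hz : ∀ t, x t - G t - A = 0 := by
    apply aux_fourier_vec J hJ2
    · fun_prop
    · intro t; rw [hxp, hGp]
    · intro m e
      have e0 : ∫ t in (0 : ℝ)..(2 * π), ⟪x t - G t - A, auxR J (m * t) e⟫
          = (∫ t in (0 : ℝ)..(2 * π), ⟪x t, auxR J (m * t) e⟫) - (∫ t in (0 : ℝ)..(2 * π), ⟪G t, auxR J (m * t) e⟫)
            - ∫ t in (0 : ℝ)..(2 * π), ⟪A, auxR J (m * t) e⟫ := by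
        simp only [inner_sub_left]
        rw [intervalIntegral.integral_sub, intervalIntegral.integral_sub]
        · exact (hx.inner (hR e m)).intervalIntegrable _ _
        · exact (hGc.inner (hR e m)).intervalIntegrable _ _
        · exact ((hx.inner (hR e m)).sub (hGc.inner (hR e m))).intervalIntegrable _ _
        · exact (continuous_const.inner (hR e m)).intervalIntegrable _ _
      by_cases hm : m = 0
      · subst hm
        simp only [Int.cast_zero, zero_mul, auxR_at_zero]
        have : ∫ t in (0 : ℝ)..(2 * π), ⟪e, x t - G t - A⟫ = 0 := by
          rw [aux_integral_inner e (by fun_prop : Continuous fun t => x t - G t - A)]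
          rw [intervalIntegral.integral_sub ((by fun_prop : Continuous fun t => x t - G t).intervalIntegrable _ _)
            (continuous_const.intervalIntegrable _ _), intervalIntegral.integral_const, hA, sub_zero, smul_smul,
            mul_inv_cancel₀ (by positivity), one_smul, sub_self, inner_zero_right]
        simpa only [real_inner_comm] using this
      · have hm' : (m : ℝ) ≠ 0 := by exact_mod_cast hm
        have e1 : ∫ t in (0 : ℝ)..(2 * π), ⟪x t, auxR J (m * t) e⟫ = ∫ t in (0 : ℝ)..(2 * π), ⟪G t, auxR J (m * t) e⟫ :=
          mul_left_cancel₀ hm' ((h m e).symm.trans (hparts m e))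
        have e2 := auxR_integral J hJ2 hJs 0 m A e
        simp only [Int.cast_zero, zero_mul, auxR_at_zero] at e2
        rw [if_neg (Ne.symm hm)] at e2
        rw [e0, e1, e2]; ring
  have hxG : x = fun t => G t + A := by
    funext t
    have := hz t
    rw [sub_sub, sub_eq_zero] at this
    exact this
  intro t
  rw [hxG]
  exact (hGd t).add_const A

end rot

section lim
variable {E : Type*} [NormedAddCommGroup E] [InnerProductSpace ℝ E] [FiniteDimensional ℝ E]

theorem aux_compact (x : ℕ → ℝ → E) (C : ℝ) (hp : ∀ j t, x j (t + 2 * π) = x j t)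
    (hC : ∀ j t, ‖x j t‖ ≤ C)
    (hm : ∀ η : ℝ, 0 < η → ∃ d : ℝ, 0 < d ∧ ∀ j s t, |s - t| < d → ‖x j s - x j t‖ < η) :
    ∃ (y : ℝ → E) (σ : ℕ → ℕ), Continuous y ∧ (∀ t, y (t + 2 * π) = y t) ∧ StrictMono σ ∧
      ∀ t, Tendsto (fun j => x (σ j) t) atTop (nhds (y t)) := by
  have hprop : ProperSpace E := FiniteDimensional.proper ℝ E
  have hxc : ∀ j, Continuous (x j) := by
    intro j
    rw [Metric.continuous_iff]
    intro t η hη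
    obtain ⟨d, hd, h⟩ := hm η hη
    refine ⟨d, hd, fun s hs => ?_⟩
    rw [dist_eq_norm]
    exact h j s t (by rwa [Real.dist_eq] at hs)
  let b : ℕ → BoundedContinuousFunction (Set.Icc (0 : ℝ) (2 * π)) E := fun j =>
    BoundedContinuousFunction.mkOfCompact ⟨fun t => x j t, (hxc j).comp continuous_subtype_val⟩
  have hb : ∀ j t, b j t = x j t := fun j t => rfl
  have hcomp : IsCompact (closure (Set.range b)) := by
    apply BoundedContinuousFunction.arzela_ascoli (Metric.closedBall 0 C) (isCompact_closedBall _ _)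
    · rintro _ t ⟨j, rfl⟩
      simpa [hb] using hC j t
    · intro t
      rw [Metric.equicontinuousAt_iff]
      intro η hη
      obtain ⟨d, hd, h⟩ := hm η hη
      refine ⟨d, hd, ?_⟩
      rintro s hs ⟨_, j, rfl⟩
      rw [dist_eq_norm]
      refine h j t s ?_
      rw [abs_sub_comm]
      rwa [Subtype.dist_eq, Real.dist_eq] at hs
  obtain ⟨l, -, σ, hσ, hl⟩ := hcomp.tendsto_subseq (fun j => subset_closure (Set.mem_range_self (f := b) j))
  have hl' : ∀ t : Set.Icc (0 : ℝ) (2 * π), Tendsto (fun j => x (σ j) t) atTop (nhds (l t)) := by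
    intro t
    have hev : Continuous fun g : BoundedContinuousFunction (Set.Icc (0 : ℝ) (2 * π)) E => g t := by
      fun_prop
    exact (hev.tendsto l).comp hl
  have h2pi : (0 : ℝ) < 2 * π := by positivity
  have hper : ∀ j, Function.Periodic (x j) (2 * π) := fun j t => hp j t
  have hex : ∀ t, ∃ v, Tendsto (fun j => x (σ j) t) atTop (nhds v) := by
    intro t
    obtain ⟨s, hs, hst⟩ : ∃ s ∈ Set.Ico (0 : ℝ) (2 * π), ∀ j, x j t = x j s := by
      refine ⟨toIcoMod h2pi 0 t, by simpa using toIcoMod_mem_Ico h2pi 0 t, fun j => ?_⟩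
      rw [toIcoMod, (hper j).sub_zsmul_eq]
    refine ⟨l ⟨s, hs.1, hs.2.le⟩, ?_⟩
    simp only [hst]
    exact hl' ⟨s, hs.1, hs.2.le⟩
  choose y hy using hex
  refine ⟨y, σ, ?_, ?_, hσ, hy⟩
  · rw [Metric.continuous_iff]
    intro t η hη
    obtain ⟨d, hd, h⟩ := hm (η / 2) (by positivity)
    refine ⟨d, hd, fun s hs => ?_⟩
    have : dist (y s) (y t) ≤ η / 2 := by
      apply le_of_tendsto' ((hy s).dist (hy t))
      intro j
      rw [dist_eq_norm]
      exact (h _ s t (by rwa [Real.dist_eq] at hs)).le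
    linarith
  · intro t
    apply tendsto_nhds_unique (hy (t + 2 * π))
    simpa only [hp] using hy t

theorem aux_int_tendsto (x : ℕ → ℝ → E) (y : ℝ → E) (C : ℝ) (hxc : ∀ j, Continuous (x j))
    (hC : ∀ j t, ‖x j t‖ ≤ C) (hy : ∀ t, Tendsto (fun j => x j t) atTop (nhds (y t)))
    (Ψ : ℝ → E → ℝ) (hΨ : Continuous fun p : ℝ × E => Ψ p.1 p.2) :
    Tendsto (fun j => ∫ t in (0 : ℝ)..(2 * π), Ψ t (x j t)) atTop
      (nhds (∫ t in (0 : ℝ)..(2 * π), Ψ t (y t))) := by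
  have hprop : ProperSpace E := FiniteDimensional.proper ℝ E
  have hcomp : IsCompact (Set.Icc (0 : ℝ) (2 * π) ×ˢ Metric.closedBall (0 : E) C) :=
    isCompact_Icc.prod (isCompact_closedBall _ _)
  obtain ⟨B, hB⟩ := hcomp.exists_bound_of_continuousOn hΨ.continuousOn
  apply intervalIntegral.tendsto_integral_filter_of_dominated_convergence (fun _ => B)
  · refine Eventually.of_forall fun j => ?_
    exact (hΨ.comp (continuous_id.prodMk (hxc j))).aestronglyMeasurable
  · refine Eventually.of_forall fun j => Eventually.of_forall fun t ht => ?_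
    rw [Set.uIoc_of_le (by positivity)] at ht
    exact hB (t, x j t) ⟨⟨ht.1.le, ht.2⟩, by simpa using hC j t⟩
  · exact continuous_const.intervalIntegrable _ _
  · refine Eventually.of_forall fun t _ => ?_
    exact (hΨ.tendsto (t, y t)).comp (tendsto_const_nhds.prodMk_nhds (hy t))

/-- passage to the limit -/
theorem aux_limit (J : E →L[ℝ] E) (hJ2 : ∀ v, J (J v) = -v)
    (hJs : ∀ u v : E, ⟪J u, v⟫ = -⟪u, J v⟫)
    (F : E → ℝ) (f : E → E) (hF : Continuous F) (hf : Continuous f) (C δ : ℝ)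
    (x x' : ℕ → ℝ → E) (hp : ∀ j t, x j (t + 2 * π) = x j t)
    (hd : ∀ j t, HasDerivAt (x j) (x' j t) t) (hx'c : ∀ j, Continuous (x' j))
    (hx' : ∀ j, ∫ t in (0 : ℝ)..(2 * π), ‖x' j t‖ ^ 2 ≤ C)
    (hx'p : ∀ j t, x' j (t + 2 * π) = x' j t)
    (hx : ∀ j, ∫ t in (0 : ℝ)..(2 * π), ‖x j t‖ ^ 2 ≤ C)
    (hcrit : ∀ m : ℤ, ∃ j₀ : ℕ, ∀ j ≥ j₀, ∀ e : E,
      |(∫ t in (0 : ℝ)..(2 * π), ⟪f (x j t), auxR J (m * t) e⟫)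
        - m * ∫ t in (0 : ℝ)..(2 * π), ⟪x j t, auxR J (m * t) e⟫| ≤ C * ‖e‖ * (1 / ((j : ℝ) + 1)))
    (hen : ∀ j, (∫ t in (0 : ℝ)..(2 * π), (1 / 2 * ⟪f (x j t), x j t⟫ - F (x j t))) ≤ - δ) :
    ∃ y : ℝ → E, (∀ t, y (t + 2 * π) = y t) ∧ (∀ t, HasDerivAt y (J (f (y t))) t) ∧
      (∫ t in (0 : ℝ)..(2 * π), (1 / 2 * ⟪f (y t), y t⟫ - F (y t))) ≤ - δ := by
  have h2pi : (0 : ℝ) < 2 * π := by positivity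
  have hxc : ∀ j, Continuous (x j) := fun j => continuous_iff_continuousAt.mpr fun t => (hd j t).continuousAt
  have hC0 : 0 ≤ C := le_trans (intervalIntegral.integral_nonneg h2pi.le (fun t _ => by positivity)) (hx 0)
  -- integral over short intervals
  have hshort : ∀ j s t, s ≤ t → t ≤ s + 2 * π → ∫ r in s..t, ‖x' j r‖ ^ 2 ≤ C := by
    intro j s t hst hts
    have hcc : Continuous fun r => ‖x' j r‖ ^ 2 := by have := hx'c j; fun_prop
    have hper : Function.Periodic (fun r => ‖x' j r‖ ^ 2) (2 * π) := fun r => by simp only [hx'p]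
    have e2 := hper.intervalIntegral_add_eq s 0
    rw [zero_add] at e2
    refine le_trans ?_ (hx' j)
    rw [← e2]
    apply intervalIntegral.integral_mono_interval le_rfl hst hts
    · exact Eventually.of_forall fun r => by positivity
    · exact hcc.intervalIntegrable _ _
  have hmod : ∀ j s t (q : ℝ), 0 < q → s ≤ t → t ≤ s + 2 * π →
      ‖x j t - x j s‖ ≤ q * C + (t - s) * q⁻¹ := by
    intro j s t q hq hst hts
    have hcc : Continuous fun r => ‖x' j r‖ ^ 2 := by have := hx'c j; fun_prop
    have e1 := intervalIntegral.integral_eq_sub_of_hasDerivAt (fun r _ => hd j r)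
      ((hx'c j).intervalIntegrable s t)
    rw [← e1]
    refine (intervalIntegral.norm_integral_le_integral_norm hst).trans ?_
    have e2 : ∫ r in s..t, ‖x' j r‖ ≤ ∫ r in s..t, (q * ‖x' j r‖ ^ 2 + q⁻¹) := by
      apply intervalIntegral.integral_mono_on hst
      · exact (hx'c j).norm.intervalIntegrable _ _
      · exact ((continuous_const.mul hcc).add continuous_const).intervalIntegrable _ _
      · intro r _
        have : 0 ≤ q⁻¹ * ((q * ‖x' j r‖ - 1) ^ 2 + q * ‖x' j r‖) := by positivity
        have h3 : q⁻¹ * ((q * ‖x' j r‖ - 1) ^ 2 + q * ‖x' j r‖) = q * ‖x' j r‖ ^ 2 + q⁻¹ - ‖x' j r‖ := by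
          field_simp; ring
        linarith
    have hcq : Continuous fun r => q * ‖x' j r‖ ^ 2 := continuous_const.mul hcc
    rw [intervalIntegral.integral_add (hcq.intervalIntegrable _ _)
      (continuous_const.intervalIntegrable _ _), intervalIntegral.integral_const_mul,
      intervalIntegral.integral_const, smul_eq_mul] at e2
    have := mul_le_mul_of_nonneg_left (hshort j s t hst hts) hq.le
    linarith
  have hm : ∀ η : ℝ, 0 < η → ∃ d : ℝ, 0 < d ∧ ∀ j s t, |s - t| < d → ‖x j s - x j t‖ < η := by
    intro η hη
    set q : ℝ := η / (2 * (C + 1)) with hq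
    have hq0 : 0 < q := by positivity
    refine ⟨min (2 * π) (η / 2 * q), by positivity, ?_⟩
    have main : ∀ j s t, s ≤ t → |s - t| < min (2 * π) (η / 2 * q) → ‖x j t - x j s‖ < η := by
      intro j s t hst hd
      rw [abs_sub_comm, abs_of_nonneg (by linarith)] at hd
      have h1 := hmod j s t q hq0 hst (by linarith [hd.trans_le (min_le_left _ _)])
      have h2 : (t - s) * q⁻¹ < η / 2 := by
        rw [← div_eq_mul_inv, div_lt_iff₀ hq0]
        exact hd.trans_le (min_le_right _ _)
      have h3 : q * C ≤ η / 2 := by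
        have : q * (C + 1) = η / 2 := by rw [hq]; field_simp
        nlinarith
      linarith
    intro j s t hst
    rcases le_total s t with h | h
    · rw [norm_sub_rev]; exact main j s t h hst
    · rw [abs_sub_comm] at hst; exact main j t s h hst
  -- uniform bound
  obtain ⟨B, hB⟩ : ∃ B : ℝ, ∀ j t, ‖x j t‖ ≤ B := by
    have h0 : ∀ j, ∀ t ∈ Set.Icc (0 : ℝ) (2 * π), ‖x j t‖ ^ 2 ≤ 2 * (C + 2 * π) ^ 2 + 2 * C := by
      intro j t ht
      have hosc : ∀ s ∈ Set.Icc (0 : ℝ) (2 * π), ‖x j t - x j s‖ ≤ C + 2 * π := by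
        intro s hs
        rcases le_total s t with h | h
        · have := hmod j s t 1 one_pos h (by linarith [ht.2, hs.1])
          rw [inv_one] at this
          linarith [ht.2, hs.1]
        · have := hmod j t s 1 one_pos h (by linarith [hs.2, ht.1])
          rw [inv_one] at this
          rw [norm_sub_rev]
          linarith [hs.2, ht.1]
      have e1 : ∫ s in (0 : ℝ)..(2 * π), ‖x j t‖ ^ 2 ≤ ∫ s in (0 : ℝ)..(2 * π), (2 * (C + 2 * π) ^ 2 + 2 * ‖x j s‖ ^ 2) := by
        have hcc : Continuous fun r => ‖x j r‖ ^ 2 := by have := hxc j; fun_prop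
        apply intervalIntegral.integral_mono_on h2pi.le
        · exact continuous_const.intervalIntegrable _ _
        · exact (continuous_const.add (continuous_const.mul hcc)).intervalIntegrable _ _
        · intro s hs
          have h1 := hosc s hs
          have h2 : ‖x j t‖ ≤ ‖x j t - x j s‖ + ‖x j s‖ := by
            simpa using norm_add_le (x j t - x j s) (x j s)
          have h3 : ‖x j t‖ ^ 2 ≤ ((C + 2 * π) + ‖x j s‖) ^ 2 := by
            apply pow_le_pow_left₀ (norm_nonneg _); linarith
          nlinarith [sq_nonneg ((C + 2 * π) - ‖x j s‖)]
      have hcc : Continuous fun r => ‖x j r‖ ^ 2 := by have := hxc j; fun_prop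
      have hcq : Continuous fun r => 2 * ‖x j r‖ ^ 2 := continuous_const.mul hcc
      rw [intervalIntegral.integral_add (continuous_const.intervalIntegrable _ _)
        (hcq.intervalIntegrable _ _), intervalIntegral.integral_const_mul,
        intervalIntegral.integral_const, intervalIntegral.integral_const, smul_eq_mul, smul_eq_mul] at e1
      rw [intervalIntegral.integral_const_mul] at e1
      have h5 := hx j
      have h6 : (1 : ℝ) ≤ 2 * π := by linarith [pi_gt_three]
      have h7 : C ≤ 2 * π * C := by nlinarith
      have h8 : 2 * π * ‖x j t‖ ^ 2 ≤ 2 * π * (2 * (C + 2 * π) ^ 2 + 2 * C) := by linarith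
      exact le_of_mul_le_mul_left h8 h2pi
    refine ⟨2 * (C + 2 * π) ^ 2 + 2 * C + 1, fun j t => ?_⟩
    have hper : Function.Periodic (x j) (2 * π) := fun t => hp j t
    obtain ⟨s, hs, hst⟩ : ∃ s ∈ Set.Ico (0 : ℝ) (2 * π), x j t = x j s := by
      refine ⟨toIcoMod h2pi 0 t, by simpa using toIcoMod_mem_Ico h2pi 0 t, ?_⟩
      rw [toIcoMod, hper.sub_zsmul_eq]
    rw [hst]
    have := h0 j s ⟨hs.1, hs.2.le⟩
    nlinarith [sq_nonneg (‖x j s‖ - 1)]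
  obtain ⟨y, σ, hyc, hyp, hσ, hy⟩ := aux_compact x B hp hB hm
  have hR : ∀ e (m : ℤ), Continuous fun t : ℝ => auxR J (m * t) e := fun e m => by
    unfold auxR; fun_prop
  have hconv : ∀ (Ψ : ℝ → E → ℝ), (Continuous fun p : ℝ × E => Ψ p.1 p.2) →
      Tendsto (fun j => ∫ t in (0 : ℝ)..(2 * π), Ψ t (x (σ j) t)) atTop
      (nhds (∫ t in (0 : ℝ)..(2 * π), Ψ t (y t))) := fun Ψ hΨ =>
    aux_int_tendsto (fun j => x (σ j)) y B (fun j => hxc _) (fun j t => hB _ t) hy Ψ hΨ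
  refine ⟨y, hyp, ?_, ?_⟩
  · apply aux_weak_solution J hJ2 hJs y (fun t => f (y t)) hyc (hf.comp hyc) hyp (fun t => by simp only [hyp])
    intro m e
    have l1 := hconv (fun t v => ⟪f v, auxR J (m * t) e⟫)
      ((hf.comp continuous_snd).inner ((hR e m).comp continuous_fst))
    have l2 := hconv (fun t v => ⟪v, auxR J (m * t) e⟫)
      (continuous_snd.inner ((hR e m).comp continuous_fst))
    have l3 := (l1.sub (l2.const_mul (m : ℝ))).abs
    have l4 : Tendsto (fun j : ℕ => C * ‖e‖ * (1 / (((σ j : ℕ) : ℝ) + 1))) atTop (nhds (C * ‖e‖ * 0)) :=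
      (tendsto_one_div_add_atTop_nhds_zero_nat.comp hσ.tendsto_atTop).const_mul _
    obtain ⟨j₀, hj₀⟩ := hcrit m
    have l5 := le_of_tendsto_of_tendsto l3 l4 (by
      filter_upwards [eventually_ge_atTop j₀] with j hj
      exact hj₀ (σ j) (hj.trans (hσ.id_le j)) e)
    rw [mul_zero] at l5
    have := abs_nonpos_iff.mp l5
    exact sub_eq_zero.mp this
  · have l1 := hconv (fun _ v => 1 / 2 * ⟪f v, v⟫ - F v) (by fun_prop)
    exact le_of_tendsto' l1 (fun j => hen _)

end lim

section gal
variable {E : Type*} [NormedAddCommGroup E] [InnerProductSpace ℝ E]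
variable {σ : Type*} [Fintype σ]

/-- trigonometric polynomial -/
noncomputable def auxX (J : E →L[ℝ] E) (μ : σ → ℤ) (c : σ → E) (t : ℝ) : E :=
  ∑ i, auxR J (μ i * t) (c i)

theorem auxX_continuous (J : E →L[ℝ] E) (μ : σ → ℤ) :
    Continuous fun p : (σ → E) × ℝ => auxX J μ p.1 p.2 := by
  unfold auxX auxR; fun_prop

theorem auxX_continuous' (J : E →L[ℝ] E) (μ : σ → ℤ) (c : σ → E) :
    Continuous (auxX J μ c) := by
  unfold auxX auxR; fun_prop

theorem auxX_add_smul (J : E →L[ℝ] E) (μ : σ → ℤ) (c d : σ → E) (s t : ℝ) :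
    auxX J μ (c + s • d) t = auxX J μ c t + s • auxX J μ d t := by
  simp only [auxX, Pi.add_apply, Pi.smul_apply, auxR_add, auxR_smul, Finset.sum_add_distrib,
    Finset.smul_sum]

theorem auxX_periodic (J : E →L[ℝ] E) (μ : σ → ℤ) (c : σ → E) (t : ℝ) :
    auxX J μ c (t + 2 * π) = auxX J μ c t := by
  simp only [auxX, auxR_periodic]

theorem auxX_hasDerivAt (J : E →L[ℝ] E) (hJ2 : ∀ v, J (J v) = -v) (μ : σ → ℤ) (c : σ → E) (t : ℝ) :
    HasDerivAt (auxX J μ c) (auxX J μ (fun i => (μ i : ℝ) • J (c i)) t) t := by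
  unfold auxX
  have := HasDerivAt.fun_sum (u := Finset.univ) (fun i _ => auxR_hasDerivAt J hJ2 (μ i) t (c i))
  refine this.congr_deriv ?_
  simp only [auxR_smul]

theorem auxX_integral (J : E →L[ℝ] E) (hJ2 : ∀ v, J (J v) = -v) (hJs : ∀ u v : E, ⟪J u, v⟫ = -⟪u, J v⟫)
    (μ : σ → ℤ) (hμ : Function.Injective μ) (c d : σ → E) :
    ∫ t in (0 : ℝ)..(2 * π), ⟪auxX J μ c t, auxX J μ d t⟫ = 2 * π * ∑ i, ⟪c i, d i⟫ := by
  classical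
  simp only [auxX, sum_inner, inner_sum]
  have hR : ∀ (m : ℤ) e, Continuous fun t : ℝ => auxR J (m * t) e := fun m e => by
    unfold auxR; fun_prop
  rw [intervalIntegral.integral_finsetSum]
  · rw [Finset.mul_sum]
    apply Finset.sum_congr rfl
    intro i _
    rw [intervalIntegral.integral_finsetSum]
    · simp only [auxR_integral J hJ2 hJs, hμ.eq_iff]
      simp
    · intro j _
      exact ((hR _ _).inner (hR _ _)).intervalIntegrable _ _
  · intro i _
    exact (continuous_finsetSum _ fun j _ => (hR _ _).inner (hR _ _)).intervalIntegrable _ _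

theorem auxX_integral_sq (J : E →L[ℝ] E) (hJ2 : ∀ v, J (J v) = -v) (hJs : ∀ u v : E, ⟪J u, v⟫ = -⟪u, J v⟫)
    (μ : σ → ℤ) (hμ : Function.Injective μ) (c : σ → E) :
    ∫ t in (0 : ℝ)..(2 * π), ‖auxX J μ c t‖ ^ 2 = 2 * π * ∑ i, ‖c i‖ ^ 2 := by
  have := auxX_integral J hJ2 hJs μ hμ c c
  simpa only [real_inner_self_eq_norm_sq] using this

theorem auxX_single [DecidableEq σ] (J : E →L[ℝ] E) (μ : σ → ℤ) (i : σ) (e : E) (t : ℝ) :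
    auxX J μ (Pi.single i e) t = auxR J (μ i * t) e := by
  unfold auxX
  rw [Finset.sum_eq_single i]
  · simp
  · intro j _ hj
    rw [Pi.single_eq_of_ne hj, auxR_zero]
  · simp

/-- the action functional on trigonometric polynomials -/
noncomputable def auxPhi (J : E →L[ℝ] E) (μ : σ → ℤ) (lam : σ → ℝ) (F : E → ℝ) (c : σ → E) : ℝ :=
  π * (∑ i, lam i * ‖c i‖ ^ 2) - ∫ t in (0 : ℝ)..(2 * π), F (auxX J μ c t)

/-- its derivative -/
noncomputable def auxD (J : E →L[ℝ] E) (μ : σ → ℤ) (lam : σ → ℝ) (f : E → E) (d c : σ → E) : ℝ :=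
  2 * π * (∑ i, lam i * ⟪c i, d i⟫) - ∫ t in (0 : ℝ)..(2 * π), ⟪f (auxX J μ c t), auxX J μ d t⟫

theorem auxPhi_continuous (J : E →L[ℝ] E) (μ : σ → ℤ) (lam : σ → ℝ) (F : E → ℝ) (hF : Continuous F) :
    Continuous (auxPhi J μ lam F) := by
  unfold auxPhi
  apply Continuous.sub
  · fun_prop
  · apply intervalIntegral.continuous_parametric_intervalIntegral_of_continuous'
    exact hF.comp (auxX_continuous J μ)

theorem auxD_continuous (J : E →L[ℝ] E) (μ : σ → ℤ) (lam : σ → ℝ) (f : E → E) (hf : Continuous f)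
    (d : σ → E) : Continuous (auxD J μ lam f d) := by
  unfold auxD
  apply Continuous.sub
  · fun_prop
  · apply intervalIntegral.continuous_parametric_intervalIntegral_of_continuous'
    exact (hf.comp (auxX_continuous J μ)).inner ((auxX_continuous' J μ d).comp continuous_snd)

theorem auxD_neg (J : E →L[ℝ] E) (μ : σ → ℤ) (lam : σ → ℝ) (f : E → E)
    (d c : σ → E) : auxD J μ lam f (-d) c = - auxD J μ lam f d c := by
  have h : ∀ t, auxX J μ (-d) t = - auxX J μ d t := by
    intro t
    have h0 : auxX J μ 0 t = 0 := by simp [auxX, auxR_zero]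
    have := auxX_add_smul J μ 0 d (-1) t
    rw [h0] at this
    simpa using this
  unfold auxD
  simp only [h, Pi.neg_apply, inner_neg_right, mul_neg, Finset.sum_neg_distrib,
    intervalIntegral.integral_neg]
  ring

/-- first order expansion -/
theorem auxPhi_expand (J : E →L[ℝ] E) (μ : σ → ℤ) (lam : σ → ℝ) (F : E → ℝ) (f : E → E)
    (hF : Continuous F) (hf : Continuous f) (hgrad : ∀ x y, F x + ⟪f x, y - x⟫ ≤ F y)
    (c d : σ → E) (s : ℝ) :
    auxPhi J μ lam F (c + s • d) ≤ auxPhi J μ lam F c + s * auxD J μ lam f d c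
      + (π * ∑ i, lam i * ‖d i‖ ^ 2) * s ^ 2 := by
  have hXc := auxX_continuous' J μ c
  have hXd := auxX_continuous' J μ d
  have h1 : (∫ t in (0 : ℝ)..(2 * π), F (auxX J μ c t))
      + s * (∫ t in (0 : ℝ)..(2 * π), ⟪f (auxX J μ c t), auxX J μ d t⟫)
      ≤ ∫ t in (0 : ℝ)..(2 * π), F (auxX J μ (c + s • d) t) := by
    rw [← intervalIntegral.integral_const_mul, ← intervalIntegral.integral_add]
    · apply intervalIntegral.integral_mono_on (by positivity)
      · apply Continuous.intervalIntegrable; fun_prop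
      · exact (hF.comp (auxX_continuous' J μ _)).intervalIntegrable _ _
      · intro t _
        have := hgrad (auxX J μ c t) (auxX J μ (c + s • d) t)
        rw [auxX_add_smul, add_sub_cancel_left, inner_smul_right] at this
        rw [auxX_add_smul]; exact this
    · apply Continuous.intervalIntegrable; fun_prop
    · apply Continuous.intervalIntegrable; fun_prop
  have h2 : ∑ i, lam i * ‖(c + s • d) i‖ ^ 2 = ∑ i, lam i * ‖c i‖ ^ 2 + 2 * s * ∑ i, lam i * ⟪c i, d i⟫
      + s ^ 2 * ∑ i, lam i * ‖d i‖ ^ 2 := by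
    rw [Finset.mul_sum, Finset.mul_sum, ← Finset.sum_add_distrib, ← Finset.sum_add_distrib]
    apply Finset.sum_congr rfl
    intro i _
    rw [Pi.add_apply, Pi.smul_apply, norm_add_sq_real, inner_smul_right, norm_smul, mul_pow,
      Real.norm_eq_abs, sq_abs]
    ring
  unfold auxPhi auxD
  rw [h2]
  linarith

theorem auxPhi_shift (J : E →L[ℝ] E) (hJ2 : ∀ v, J (J v) = -v) (hJs : ∀ u v : E, ⟪J u, v⟫ = -⟪u, J v⟫)
    (μ : σ → ℤ) (hμ : Function.Injective μ) (lam : σ → ℝ) (F : E → ℝ) (hF : Continuous F) (a : ℝ)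
    (c : σ → E) : auxPhi J μ lam F c = π * (∑ i, (lam i - a) * ‖c i‖ ^ 2)
      - ∫ t in (0 : ℝ)..(2 * π), (F (auxX J μ c t) - a / 2 * ‖auxX J μ c t‖ ^ 2) := by
  have hXc := auxX_continuous' J μ c
  rw [intervalIntegral.integral_sub, intervalIntegral.integral_const_mul,
    auxX_integral_sq J hJ2 hJs μ hμ]
  · unfold auxPhi
    simp only [sub_mul, Finset.sum_sub_distrib, ← Finset.mul_sum]
    ring
  · apply Continuous.intervalIntegrable; fun_prop
  · apply Continuous.intervalIntegrable; fun_prop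

end gal

section galerkin
variable {E : Type*} [NormedAddCommGroup E] [InnerProductSpace ℝ E] [FiniteDimensional ℝ E]
variable {ι κ : Type*} [Fintype ι] [Fintype κ]

theorem aux_galerkin (J : E →L[ℝ] E) (hJ2 : ∀ v, J (J v) = -v) (hJs : ∀ u v : E, ⟪J u, v⟫ = -⟪u, J v⟫)
    (μ : ι ⊕ κ → ℤ) (hμ : Function.Injective μ) (lam : ι ⊕ κ → ℝ)
    (F : E → ℝ) (f : E → E) (hF : Continuous F) (hf : Continuous f)
    (hgrad : ∀ x y, F x + ⟪f x, y - x⟫ ≤ F y)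
    (a b k c₀ ε : ℝ) (hε : 0 < ε) (hak : a ≤ k) (hbk : b < k)
    (hl1 : ∀ i, lam (Sum.inl i) ≤ a - ε) (hl2 : ∀ j, k ≤ lam (Sum.inr j))
    (hN : ConvexOn ℝ Set.univ fun x => F x - a / 2 * ‖x‖ ^ 2)
    (hN0 : ∀ x, 0 ≤ F x - a / 2 * ‖x‖ ^ 2)
    (hup : ∀ x, F x ≤ b / 2 * ‖x‖ ^ 2 + c₀) :
    ∃ c : ι ⊕ κ → E,
      (∀ i e, 2 * π * (lam i * ⟪c i, e⟫) = ∫ t in (0 : ℝ)..(2 * π), ⟪f (auxX J μ c t), auxR J (μ i * t) e⟫) ∧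
      (∀ z : κ → E, ∃ y : ι → E, auxPhi J μ lam F c ≤ auxPhi J μ lam F (Sum.elim y z)) ∧
      auxPhi J μ lam F (Sum.elim 0 (fun j => c (Sum.inr j))) ≤ auxPhi J μ lam F c := by
  classical
  have helim : Continuous fun p : (ι → E) × (κ → E) => (Sum.elim p.1 p.2 : ι ⊕ κ → E) := by
    apply continuous_pi
    rintro (i | j)
    · simp only [Sum.elim_inl]; fun_prop
    · simp only [Sum.elim_inr]; fun_prop
  have hXN : ∀ c : ι ⊕ κ → E, Continuous fun t => F (auxX J μ c t) - a / 2 * ‖auxX J μ c t‖ ^ 2 := by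
    intro c
    have := auxX_continuous' J μ c
    fun_prop
  have hsh := auxPhi_shift J hJ2 hJs μ hμ lam F hF
  obtain ⟨y₀, z₀, hmax, hmin, hcr⟩ := aux_saddle (fun (y : ι → E) (z : κ → E) => auxPhi J μ lam F (Sum.elim y z))
    ((auxPhi_continuous J μ lam F hF).comp helim)
    (by
      intro z y₁ y₂ hne
      refine ⟨(1 / 2 : ℝ) • (y₁ + y₂), ?_⟩
      rw [min_lt_iff]
      by_contra! hcon
      obtain ⟨hc1, hc2⟩ := hcon
      set c₁ : ι ⊕ κ → E := Sum.elim y₁ z with hc₁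
      set c₂ : ι ⊕ κ → E := Sum.elim y₂ z with hc₂
      set cm : ι ⊕ κ → E := Sum.elim ((1 / 2 : ℝ) • (y₁ + y₂)) z with hcm
      have hcm' : ∀ i, cm i = (1 / 2 : ℝ) • c₁ i + (1 / 2 : ℝ) • c₂ i := by
        rintro (i | j)
        · simp [hcm, hc₁, hc₂]
        · simp only [hcm, hc₁, hc₂, Sum.elim_inr]
          module
      have hXm : ∀ t, auxX J μ cm t = (1 / 2 : ℝ) • auxX J μ c₁ t + (1 / 2 : ℝ) • auxX J μ c₂ t := by
        intro t
        simp only [auxX, hcm', auxR_add, auxR_smul, Finset.sum_add_distrib, Finset.smul_sum]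
      have hint : ∫ t in (0 : ℝ)..(2 * π), (F (auxX J μ cm t) - a / 2 * ‖auxX J μ cm t‖ ^ 2)
          ≤ 1 / 2 * (∫ t in (0 : ℝ)..(2 * π), (F (auxX J μ c₁ t) - a / 2 * ‖auxX J μ c₁ t‖ ^ 2))
            + 1 / 2 * (∫ t in (0 : ℝ)..(2 * π), (F (auxX J μ c₂ t) - a / 2 * ‖auxX J μ c₂ t‖ ^ 2)) := by
        rw [← intervalIntegral.integral_const_mul, ← intervalIntegral.integral_const_mul,
          ← intervalIntegral.integral_add]
        · apply intervalIntegral.integral_mono_on (by positivity)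
          · exact (hXN cm).intervalIntegrable _ _
          · exact ((continuous_const.mul (hXN c₁)).add (continuous_const.mul (hXN c₂))).intervalIntegrable _ _
          · intro t _
            rw [hXm]
            have := hN.2 (Set.mem_univ (auxX J μ c₁ t)) (Set.mem_univ (auxX J μ c₂ t))
              (by norm_num : (0 : ℝ) ≤ 1 / 2) (by norm_num : (0 : ℝ) ≤ 1 / 2) (by norm_num)
            simpa only [smul_eq_mul] using this
        · exact (continuous_const.mul (hXN c₁)).intervalIntegrable _ _
        · exact (continuous_const.mul (hXN c₂)).intervalIntegrable _ _
      have hq : ∑ i, (lam i - a) * ‖cm i‖ ^ 2 = 1 / 2 * ∑ i, (lam i - a) * ‖c₁ i‖ ^ 2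
          + 1 / 2 * ∑ i, (lam i - a) * ‖c₂ i‖ ^ 2 - 1 / 4 * ∑ i, (lam i - a) * ‖c₁ i - c₂ i‖ ^ 2 := by
        rw [Finset.mul_sum, Finset.mul_sum, Finset.mul_sum, ← Finset.sum_add_distrib, ← Finset.sum_sub_distrib]
        apply Finset.sum_congr rfl
        intro i _
        rw [hcm', norm_add_sq_real, norm_sub_sq_real, norm_smul, norm_smul, inner_smul_left, inner_smul_right]
        simp
        ring
      have hneg : ∑ i, (lam i - a) * ‖c₁ i - c₂ i‖ ^ 2 < 0 := by
        rw [Fintype.sum_sum_type]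
        simp only [hc₁, hc₂, Sum.elim_inl, Sum.elim_inr, sub_self, norm_zero]
        obtain ⟨i₀, hi₀⟩ := Function.ne_iff.mp hne
        have : ∑ i, (lam (Sum.inl i) - a) * ‖y₁ i - y₂ i‖ ^ 2 < ∑ i : ι, (0 : ℝ) := by
          apply Finset.sum_lt_sum
          · intro i _
            have := hl1 i
            exact mul_nonpos_of_nonpos_of_nonneg (by linarith) (by positivity)
          · refine ⟨i₀, Finset.mem_univ _, ?_⟩
            have := hl1 i₀
            have h3 : 0 < ‖y₁ i₀ - y₂ i₀‖ := norm_pos_iff.mpr (sub_ne_zero.mpr hi₀)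
            exact mul_neg_of_neg_of_pos (by linarith) (by positivity)
        simpa using this
      rw [hsh a c₁, hsh a cm, hq] at hc1
      rw [hsh a c₂, hsh a cm, hq] at hc2
      have := pi_pos
      nlinarith)
    (by
      intro R c
      set S : ℝ := ∑ j, (lam (Sum.inr j) - a) with hS
      set q : ℝ := (π * (S * R ^ 2) - c) / (π * ε) with hq
      refine ⟨|q| + 1, fun y z hz hc => ?_⟩
      rw [hsh a, Fintype.sum_sum_type] at hc
      simp only [Sum.elim_inl, Sum.elim_inr] at hc
      have h1 : 0 ≤ ∫ t in (0 : ℝ)..(2 * π), (F (auxX J μ (Sum.elim y z) t) - a / 2 * ‖auxX J μ (Sum.elim y z) t‖ ^ 2) :=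
        intervalIntegral.integral_nonneg (by positivity) (fun t _ => hN0 _)
      have h2 : ∑ j, (lam (Sum.inr j) - a) * ‖z j‖ ^ 2 ≤ S * R ^ 2 := by
        rw [hS, Finset.sum_mul]
        apply Finset.sum_le_sum
        intro j _
        have := hl2 j
        apply mul_le_mul_of_nonneg_left _ (by linarith)
        exact pow_le_pow_left₀ (norm_nonneg _) ((norm_le_pi_norm z j).trans hz) 2
      have h3 : ∀ i, ‖y i‖ ^ 2 ≤ q := by
        intro i
        have h4 : ∑ i, (lam (Sum.inl i) - a) * ‖y i‖ ^ 2 ≤ - (ε * ‖y i‖ ^ 2) := by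
          calc ∑ i, (lam (Sum.inl i) - a) * ‖y i‖ ^ 2 ≤ ∑ i, - (ε * ‖y i‖ ^ 2) := by
                apply Finset.sum_le_sum
                intro i _
                have := hl1 i
                nlinarith [sq_nonneg ‖y i‖]
            _ = - ∑ i, (ε * ‖y i‖ ^ 2) := by rw [Finset.sum_neg_distrib]
            _ ≤ _ := by
                apply neg_le_neg
                exact Finset.single_le_sum (f := fun i => ε * ‖y i‖ ^ 2) (fun i _ => by positivity) (Finset.mem_univ i)
        rw [hq, le_div_iff₀ (by positivity)]
        have := pi_pos
        nlinarith
      rw [pi_norm_le_iff_of_nonneg (by positivity)]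
      intro i
      have := h3 i
      have h5 := le_abs_self q
      nlinarith [sq_nonneg (‖y i‖ - 1)])
    (by
      intro c
      set q : ℝ := (c + 2 * π * c₀) / (π * (k - b)) with hq
      refine ⟨|q| + 1, fun z hc => ?_⟩
      rw [hsh b, Fintype.sum_sum_type] at hc
      simp only [Sum.elim_inl, Sum.elim_inr, Pi.zero_apply, norm_zero] at hc
      have h1 : ∫ t in (0 : ℝ)..(2 * π), (F (auxX J μ (Sum.elim 0 z) t) - b / 2 * ‖auxX J μ (Sum.elim 0 z) t‖ ^ 2)
          ≤ 2 * π * c₀ := by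
        have hXc := auxX_continuous' J μ (Sum.elim 0 z)
        have : ∫ t in (0 : ℝ)..(2 * π), (F (auxX J μ (Sum.elim 0 z) t) - b / 2 * ‖auxX J μ (Sum.elim 0 z) t‖ ^ 2)
          ≤ ∫ t in (0 : ℝ)..(2 * π), c₀ := by
          apply intervalIntegral.integral_mono_on (by positivity)
          · apply Continuous.intervalIntegrable; fun_prop
          · exact continuous_const.intervalIntegrable _ _
          · intro t _
            have := hup (auxX J μ (Sum.elim 0 z) t)
            linarith
        simpa using this
      have hkb : 0 < k - b := by linarith
      have h3 : ∀ i, ‖z i‖ ^ 2 ≤ q := by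
        intro i
        have h4 : (k - b) * ‖z i‖ ^ 2 ≤ ∑ i, (lam (Sum.inr i) - b) * ‖z i‖ ^ 2 := by
          calc (k - b) * ‖z i‖ ^ 2 ≤ ∑ i, (k - b) * ‖z i‖ ^ 2 :=
                Finset.single_le_sum (f := fun i => (k - b) * ‖z i‖ ^ 2) (fun i _ => by positivity) (Finset.mem_univ i)
            _ ≤ _ := by
                apply Finset.sum_le_sum
                intro i _
                have := hl2 i
                nlinarith [sq_nonneg ‖z i‖]
        rw [hq, le_div_iff₀ (by positivity)]
        have := pi_pos
        simp only [ne_eq, OfNat.ofNat_ne_zero, not_false_eq_true, zero_pow, mul_zero,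
          Finset.sum_const_zero, zero_add] at hc
        nlinarith
      rw [pi_norm_le_iff_of_nonneg (by positivity)]
      intro i
      have := h3 i
      have h5 := le_abs_self q
      nlinarith [sq_nonneg (‖z i‖ - 1)])
  set c : ι ⊕ κ → E := Sum.elim y₀ z₀ with hc
  have hDz : ∀ w : κ → E, 0 ≤ auxD J μ lam f (Sum.elim 0 w) c := by
    intro w
    apply hcr w (fun y => auxD J μ lam f (Sum.elim 0 w) (Sum.elim y z₀))
      (π * ∑ i, lam i * ‖(Sum.elim 0 w : ι ⊕ κ → E) i‖ ^ 2)
    · exact (auxD_continuous J μ lam f hf _).comp (helim.comp (continuous_id.prodMk continuous_const))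
    · intro y t _ _
      have := auxPhi_expand J μ lam F f hF hf hgrad (Sum.elim y z₀) (Sum.elim 0 w) t
      have he : (Sum.elim y (z₀ + t • w) : ι ⊕ κ → E) = Sum.elim y z₀ + t • Sum.elim (0 : ι → E) w := by
        funext i
        rcases i with i | j <;> simp
      rw [he]; exact this
  have hDy : ∀ v : ι → E, auxD J μ lam f (Sum.elim v 0) c ≤ 0 := by
    intro v
    set d : ι ⊕ κ → E := Sum.elim v 0 with hd
    have h1 : ∀ t : ℝ, 0 < t → auxD J μ lam f d (c + t • d) ≤ (π * ∑ i, lam i * ‖d i‖ ^ 2) * t := by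
      intro t ht
      have e1 := auxPhi_expand J μ lam F f hF hf hgrad (c + t • d) d (-t)
      have e2 : c + t • d + (-t) • d = c := by module
      rw [e2] at e1
      have e3 := hmax (y₀ + t • v)
      have he : (Sum.elim (y₀ + t • v) z₀ : ι ⊕ κ → E) = c + t • d := by
        funext i
        rcases i with i | j <;> simp [hc, hd]
      simp only [he] at e3
      have e4 : t * auxD J μ lam f d (c + t • d) ≤ t * ((π * ∑ i, lam i * ‖d i‖ ^ 2) * t) := by nlinarith
      exact le_of_mul_le_mul_left e4 ht
    have l1 : Tendsto (fun t : ℝ => auxD J μ lam f d (c + t • d)) (nhdsWithin 0 (Set.Ioi 0))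
        (nhds (auxD J μ lam f d (c + (0 : ℝ) • d))) := by
      apply tendsto_nhdsWithin_of_tendsto_nhds
      exact ((auxD_continuous J μ lam f hf d).comp (by fun_prop : Continuous fun t : ℝ => c + t • d)).tendsto 0
    have l2 : Tendsto (fun t : ℝ => (π * ∑ i, lam i * ‖d i‖ ^ 2) * t) (nhdsWithin 0 (Set.Ioi 0))
        (nhds ((π * ∑ i, lam i * ‖d i‖ ^ 2) * 0)) := by
      apply tendsto_nhdsWithin_of_tendsto_nhds
      exact (by fun_prop : Continuous fun t : ℝ => (π * ∑ i, lam i * ‖d i‖ ^ 2) * t).tendsto 0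
    have := le_of_tendsto_of_tendsto l1 l2 (by
      filter_upwards [self_mem_nhdsWithin] with t ht
      exact h1 t ht)
    simpa using this
  have hD0 : ∀ i e, auxD J μ lam f (Pi.single i e) c = 0 := by
    rintro (i | j) e
    · rw [← Sum.elim_single_zero]
      have h1 := hDy (Pi.single i e)
      have h2 := hDy (-Pi.single i e)
      have h3 : (Sum.elim (-Pi.single i e) 0 : ι ⊕ κ → E) = - Sum.elim (Pi.single i e) (0 : κ → E) := by
        funext i
        rcases i with i | j <;> simp only [Sum.elim_inl, Sum.elim_inr, Pi.neg_apply, Pi.zero_apply, neg_zero]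
      rw [h3, auxD_neg] at h2
      linarith
    · rw [← Sum.elim_zero_single]
      have h1 := hDz (Pi.single j e)
      have h2 := hDz (-Pi.single j e)
      have h3 : (Sum.elim 0 (-Pi.single j e) : ι ⊕ κ → E) = - Sum.elim (0 : ι → E) (Pi.single j e) := by
        funext i
        rcases i with i | j <;> simp only [Sum.elim_inl, Sum.elim_inr, Pi.neg_apply, Pi.zero_apply, neg_zero]
      rw [h3, auxD_neg] at h2
      linarith
  refine ⟨c, ?_, ?_, ?_⟩
  · intro i e
    have := hD0 i e
    unfold auxD at this
    simp only [auxX_single] at this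
    rw [Finset.sum_eq_single i (by intro j _ hj; rw [Pi.single_eq_of_ne hj]; simp) (by simp),
      Pi.single_eq_same] at this
    linarith
  · exact hmin
  · exact hmax 0

end galerkin

section bounds
variable {E : Type*} [NormedAddCommGroup E] [InnerProductSpace ℝ E]

theorem aux_growth (F : E → ℝ) (f : E → E) (hgrad : ∀ x y, F x + ⟪f x, y - x⟫ ≤ F y)
    (hF0 : ∀ x, 0 ≤ F x) (b c₀ : ℝ) (hup : ∀ x, F x ≤ b / 2 * ‖x‖ ^ 2 + c₀) (x : E) :
    ‖f x‖ ≤ (2 * |b| + |c₀|) * (1 + ‖x‖) := by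
  by_cases h0 : f x = 0
  · rw [h0, norm_zero]; positivity
  have hfp : 0 < ‖f x‖ := norm_pos_iff.mpr h0
  have hs : 0 < 1 + ‖x‖ := by positivity
  set w : E := ((1 + ‖x‖) / ‖f x‖) • f x with hw
  have hwn : ‖w‖ = 1 + ‖x‖ := by
    rw [hw, norm_smul, Real.norm_eq_abs, abs_of_nonneg (by positivity)]
    field_simp
  have h1 := hgrad x (x + w)
  have h2 : ⟪f x, x + w - x⟫ = (1 + ‖x‖) * ‖f x‖ := by
    rw [add_sub_cancel_left, hw, inner_smul_right, real_inner_self_eq_norm_sq]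
    field_simp
  rw [h2] at h1
  have h3 := hup (x + w)
  have h4 := hF0 x
  have h5 : ‖x + w‖ ≤ 2 * (1 + ‖x‖) := by
    refine (norm_add_le _ _).trans ?_
    rw [hwn]; linarith
  have h6 : b / 2 * ‖x + w‖ ^ 2 ≤ |b| / 2 * (2 * (1 + ‖x‖)) ^ 2 := by
    refine le_trans (mul_le_mul_of_nonneg_right (by linarith [le_abs_self b] : b / 2 ≤ |b| / 2) (by positivity)) ?_
    gcongr
  have h7 : c₀ ≤ |c₀| * (1 + ‖x‖) ^ 2 := by
    have := le_abs_self c₀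
    have h8 : (1 : ℝ) ≤ (1 + ‖x‖) ^ 2 := by nlinarith [norm_nonneg x]
    nlinarith [abs_nonneg c₀]
  have h9 : (1 + ‖x‖) * ‖f x‖ ≤ (1 + ‖x‖) * ((2 * |b| + |c₀|) * (1 + ‖x‖)) := by nlinarith
  exact le_of_mul_le_mul_left h9 hs

theorem aux_lin_lower (N : E → ℝ) (hN : ConvexOn ℝ Set.univ N) (hN0 : N 0 = 0) (g r : ℝ) (hr : 0 < r)
    (hloc : ∀ x, ‖x‖ ≤ r → g / 2 * ‖x‖ ^ 2 ≤ N x) (x : E) (hx : r ≤ ‖x‖) : g * r / 2 * ‖x‖ ≤ N x := by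
  have hxp : 0 < ‖x‖ := by linarith
  have h1 := hloc ((r / ‖x‖) • x) (by
    rw [norm_smul, Real.norm_eq_abs, abs_of_nonneg (by positivity)]; field_simp; rfl)
  have h2 := hN.2 (Set.mem_univ x) (Set.mem_univ 0) (by positivity : 0 ≤ r / ‖x‖)
    (by rw [sub_nonneg, div_le_one hxp]; exact hx : 0 ≤ 1 - r / ‖x‖) (by ring)
  rw [smul_zero, add_zero, hN0, smul_zero, add_zero, smul_eq_mul] at h2
  have h3 : ‖(r / ‖x‖) • x‖ = r := by
    rw [norm_smul, Real.norm_eq_abs, abs_of_nonneg (by positivity)]; field_simp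
  rw [h3] at h1
  have h4 : g / 2 * r ^ 2 ≤ r / ‖x‖ * N x := h1.trans h2
  rw [div_mul_eq_mul_div r, le_div_iff₀ hxp] at h4
  have h5 : r * (g * r / 2 * ‖x‖) ≤ r * N x := by nlinarith
  exact le_of_mul_le_mul_left h5 hr

theorem aux_young_lower (N : E → ℝ) (hN : ConvexOn ℝ Set.univ N) (hN0 : N 0 = 0) (g r : ℝ) (hr : 0 < r)
    (hg : 0 < g)
    (hloc : ∀ x, ‖x‖ ≤ r → g / 2 * ‖x‖ ^ 2 ≤ N x) (v x : E) (hv : ‖v‖ ≤ g * r / 2) :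
    ⟪v, x⟫ - ‖v‖ ^ 2 / (2 * g) ≤ N x := by
  have h0 := real_inner_le_norm v x
  rcases le_total ‖x‖ r with h | h
  · have h1 := hloc x h
    have h2 : ‖v‖ * ‖x‖ - ‖v‖ ^ 2 / (2 * g) ≤ g / 2 * ‖x‖ ^ 2 := by
      have : g / 2 * ‖x‖ ^ 2 - (‖v‖ * ‖x‖ - ‖v‖ ^ 2 / (2 * g)) = (g * ‖x‖ - ‖v‖) ^ 2 / (2 * g) := by
        field_simp; ring
      have h3 : 0 ≤ (g * ‖x‖ - ‖v‖) ^ 2 / (2 * g) := by positivity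
      linarith
    linarith
  · have h1 := aux_lin_lower N hN hN0 g r hr hloc x h
    have h2 : 0 ≤ ‖v‖ ^ 2 / (2 * g) := by positivity
    have h3 : ‖v‖ * ‖x‖ ≤ g * r / 2 * ‖x‖ := by gcongr
    linarith

variable {ι κ : Type*} [Fintype ι] [Fintype κ]

theorem aux_delta (J : E →L[ℝ] E) (hJ2 : ∀ v, J (J v) = -v) (hJs : ∀ u v : E, ⟪J u, v⟫ = -⟪u, J v⟫)
    (μ : ι ⊕ κ → ℤ) (hμ : Function.Injective μ) (lam : ι ⊕ κ → ℝ)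
    (F : E → ℝ) (hF : Continuous F) (a k ω r : ℝ) (haω : a < ω) (hr : 0 < r)
    (hl1 : ∀ i, lam (Sum.inl i) ≤ a) (j₀ : κ) (hj₀ : lam (Sum.inr j₀) = k)
    (hN : ConvexOn ℝ Set.univ fun x => F x - a / 2 * ‖x‖ ^ 2)
    (hF0 : F 0 = 0) (hloc : ∀ x, ‖x‖ ≤ r → ω / 2 * ‖x‖ ^ 2 ≤ F x) (e : E) (he : ‖e‖ = 1) :
    ∃ z : κ → E, ∀ y : ι → E, auxPhi J μ lam F (Sum.elim y z) ≤ π * (r / 2) ^ 2 * (k - ω) := by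
  classical
  have hg : 0 < ω - a := by linarith
  set z : κ → E := Pi.single j₀ ((r / 2) • e) with hz
  refine ⟨z, fun y => ?_⟩
  set c : ι ⊕ κ → E := Sum.elim y z with hc
  set d : ι ⊕ κ → E := Pi.single (Sum.inr j₀) (((ω - a) * (r / 2)) • e) with hd
  have hXc := auxX_continuous' J μ c
  have hXd := auxX_continuous' J μ d
  have hdn : ∀ t, ‖auxX J μ d t‖ = (ω - a) * (r / 2) := by
    intro t
    rw [hd, auxX_single, auxR_norm J hJ2 hJs, norm_smul, he, Real.norm_eq_abs,
      abs_of_nonneg (by positivity), mul_one]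
  have h1 : (∫ t in (0 : ℝ)..(2 * π), (⟪auxX J μ d t, auxX J μ c t⟫ - (ω - a) * (r / 2) ^ 2 / 2))
      ≤ ∫ t in (0 : ℝ)..(2 * π), (F (auxX J μ c t) - a / 2 * ‖auxX J μ c t‖ ^ 2) := by
    apply intervalIntegral.integral_mono_on (by positivity)
    · apply Continuous.intervalIntegrable; fun_prop
    · apply Continuous.intervalIntegrable; fun_prop
    · intro t _
      have := aux_young_lower (fun x => F x - a / 2 * ‖x‖ ^ 2) hN (by simp [hF0]) (ω - a) r hr hg
        (by intro x hx; have := hloc x hx; linarith) (auxX J μ d t) (auxX J μ c t)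
        (by rw [hdn]; linarith)
      rw [hdn] at this
      refine le_trans (le_of_eq ?_) this
      field_simp
  rw [intervalIntegral.integral_sub (by apply Continuous.intervalIntegrable; fun_prop)
    (by apply Continuous.intervalIntegrable; fun_prop), auxX_integral J hJ2 hJs μ hμ] at h1
  have h2 : ∑ i, ⟪d i, c i⟫ = (ω - a) * (r / 2) ^ 2 := by
    rw [Finset.sum_eq_single (Sum.inr j₀)]
    · simp only [hd, hc, hz, Sum.elim_inr, Pi.single_eq_same, inner_smul_left, inner_smul_right,
        real_inner_self_eq_norm_sq, he]
      simp; ring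
    · intro j _ hj
      rw [hd, Pi.single_eq_of_ne hj, inner_zero_left]
    · simp
  rw [h2, intervalIntegral.integral_const, smul_eq_mul] at h1
  rw [auxPhi_shift J hJ2 hJs μ hμ lam F hF a, Fintype.sum_sum_type]
  have h3 : ∑ i, (lam (Sum.inl i) - a) * ‖c (Sum.inl i)‖ ^ 2 ≤ 0 := by
    apply Finset.sum_nonpos
    intro i _
    exact mul_nonpos_of_nonpos_of_nonneg (by linarith [hl1 i]) (by positivity)
  have h4 : ∑ j, (lam (Sum.inr j) - a) * ‖c (Sum.inr j)‖ ^ 2 = (k - a) * (r / 2) ^ 2 := by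
    rw [Finset.sum_eq_single j₀]
    · simp only [hc, hz, Sum.elim_inr, Pi.single_eq_same, norm_smul, he, hj₀]
      rw [Real.norm_eq_abs, abs_of_nonneg (by positivity), mul_one]
    · intro j _ hj
      simp only [hc, hz, Sum.elim_inr]
      rw [Pi.single_eq_of_ne hj, norm_zero]; ring
    · simp
  rw [h4]
  have := pi_pos
  nlinarith

end bounds

section uniform
variable {E : Type*} [NormedAddCommGroup E] [InnerProductSpace ℝ E]
variable {ι κ : Type*} [Fintype ι] [Fintype κ]

set_option maxHeartbeats 1000000 in
/-- `L²` bound on the Galerkin critical points -/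
theorem aux_l2_bound (J : E →L[ℝ] E) (hJ2 : ∀ v, J (J v) = -v) (hJs : ∀ u v : E, ⟪J u, v⟫ = -⟪u, J v⟫)
    (μ : ι ⊕ κ → ℤ) (hμ : Function.Injective μ) (lam : ι ⊕ κ → ℝ)
    (F : E → ℝ) (hF : Continuous F) (a b k c₀ ω r : ℝ) (hbk : b < k) (haω : a < ω) (hr : 0 < r)
    (i₀ : ι) (hl1 : ∀ i, lam (Sum.inl i) ≤ a) (hl1' : ∀ i, i ≠ i₀ → lam (Sum.inl i) ≤ a - 1)
    (hl2 : ∀ j, k ≤ lam (Sum.inr j))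
    (hN : ConvexOn ℝ Set.univ fun x => F x - a / 2 * ‖x‖ ^ 2)
    (hN0 : ∀ x, 0 ≤ F x - a / 2 * ‖x‖ ^ 2)
    (hF0 : F 0 = 0) (hup : ∀ x, F x ≤ b / 2 * ‖x‖ ^ 2 + c₀)
    (hloc : ∀ x, ‖x‖ ≤ r → ω / 2 * ‖x‖ ^ 2 ≤ F x) (C₁ C₂ C₃ : ℝ)
    (hC₁ : C₁ = 2 * c₀ / (k - b)) (hC₂ : C₂ = 4 * c₀ + |b - a| * C₁)
    (hC₃ : C₃ = (π * C₂ + 2 * π * ((ω - a) * r / 2 * r)) / ((ω - a) * r / 2))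
    (c : ι ⊕ κ → E) (hc1 : auxPhi J μ lam F (Sum.elim 0 (fun j => c (Sum.inr j))) ≤ auxPhi J μ lam F c)
    (hc2 : auxPhi J μ lam F c ≤ 0) :
    ∑ i, ‖c i‖ ^ 2 ≤ C₂ + (C₃ / (2 * π)) ^ 2 + C₁ := by
  classical
  have hpi := pi_pos
  have hc₀ : 0 ≤ c₀ := by have := hup 0; rw [hF0] at this; simpa using this
  have hkb : 0 < k - b := by linarith
  have hg : 0 < ω - a := by linarith
  have hC₁0 : 0 ≤ C₁ := by rw [hC₁]; positivity
  have hsh := auxPhi_shift J hJ2 hJs μ hμ lam F hF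
  have hXc := auxX_continuous' J μ c
  set c' : ι ⊕ κ → E := Sum.elim 0 (fun j => c (Sum.inr j)) with hc'
  have hXc' := auxX_continuous' J μ c'
  have e1 := hsh b c'
  rw [Fintype.sum_sum_type] at e1
  have e2 : ∑ i : ι, (lam (Sum.inl i) - b) * ‖c' (Sum.inl i)‖ ^ 2 = 0 := by
    apply Finset.sum_eq_zero
    intro i _
    simp [hc']
  have e3 : ∫ t in (0 : ℝ)..(2 * π), (F (auxX J μ c' t) - b / 2 * ‖auxX J μ c' t‖ ^ 2) ≤ 2 * π * c₀ := by
    have : ∫ t in (0 : ℝ)..(2 * π), (F (auxX J μ c' t) - b / 2 * ‖auxX J μ c' t‖ ^ 2)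
      ≤ ∫ t in (0 : ℝ)..(2 * π), c₀ := by
      apply intervalIntegral.integral_mono_on (by positivity)
      · apply Continuous.intervalIntegrable; fun_prop
      · exact continuous_const.intervalIntegrable _ _
      · intro t _
        have := hup (auxX J μ c' t)
        linarith
    simpa using this
  have e4 : ∀ j, c' (Sum.inr j) = c (Sum.inr j) := fun j => by simp [hc']
  simp only [e2, e4, zero_add] at e1
  set S1 := ∑ j, (lam (Sum.inr j) - b) * ‖c (Sum.inr j)‖ ^ 2 with hS1
  set S := ∑ j, ‖c (Sum.inr j)‖ ^ 2 with hS
  have f1 : S1 ≤ 2 * c₀ := by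
    have : π * S1 ≤ π * (2 * c₀) := by linarith
    exact le_of_mul_le_mul_left this hpi
  have f2 : (k - b) * S ≤ S1 := by
    rw [hS, hS1, Finset.mul_sum]
    apply Finset.sum_le_sum
    intro j _
    have := hl2 j
    gcongr
  have hS0 : 0 ≤ S := Finset.sum_nonneg fun j _ => by positivity
  have f3 : S ≤ C₁ := by
    rw [hC₁, le_div_iff₀ hkb]; linarith
  have f4 : ∑ j, (lam (Sum.inr j) - a) * ‖c (Sum.inr j)‖ ^ 2 = S1 + (b - a) * S := by
    rw [hS, hS1, Finset.mul_sum, ← Finset.sum_add_distrib]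
    apply Finset.sum_congr rfl
    intro j _
    ring
  have f5 : (b - a) * S ≤ |b - a| * C₁ := by
    have h1 := le_abs_self (b - a)
    calc (b - a) * S ≤ |b - a| * S := by gcongr
      _ ≤ _ := by gcongr
  have f6 : -(2 * π * c₀) ≤ auxPhi J μ lam F c := by
    have : 0 ≤ (k - b) * S := by positivity
    have : 0 ≤ π * S1 := mul_nonneg hpi.le (by linarith)
    linarith
  rw [hsh a c, Fintype.sum_sum_type, f4] at f6
  set I := ∫ t in (0 : ℝ)..(2 * π), (F (auxX J μ c t) - a / 2 * ‖auxX J μ c t‖ ^ 2) with hI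
  have hI0 : 0 ≤ I := intervalIntegral.integral_nonneg (by positivity) fun t _ => hN0 _
  set Y := ∑ i, (a - lam (Sum.inl i)) * ‖c (Sum.inl i)‖ ^ 2 with hY
  have hY0 : 0 ≤ Y := Finset.sum_nonneg fun i _ => mul_nonneg (by linarith [hl1 i]) (by positivity)
  have f7 : ∑ i, (lam (Sum.inl i) - a) * ‖c (Sum.inl i)‖ ^ 2 = - Y := by
    rw [hY, ← Finset.sum_neg_distrib]
    apply Finset.sum_congr rfl
    intro i _
    ring
  rw [f7] at f6
  have f8 : π * Y + I ≤ π * C₂ := by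
    have : π * ((b - a) * S) ≤ π * (|b - a| * C₁) := by gcongr
    have : π * S1 ≤ π * (2 * c₀) := by gcongr
    rw [hC₂]
    linarith
  have f9 : Y ≤ C₂ := by
    have : π * Y ≤ π * C₂ := by linarith
    exact le_of_mul_le_mul_left this hpi
  -- the L¹ bound
  set p : ℝ := (ω - a) * r / 2 with hp
  have hp0 : 0 < p := by positivity
  have g1 : ∫ t in (0 : ℝ)..(2 * π), ‖auxX J μ c t‖ ≤ C₃ := by
    have h1 : ∫ t in (0 : ℝ)..(2 * π), (p * ‖auxX J μ c t‖ - p * r) ≤ I := by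
      apply intervalIntegral.integral_mono_on (by positivity)
      · apply Continuous.intervalIntegrable; fun_prop
      · apply Continuous.intervalIntegrable; fun_prop
      · intro t _
        rcases le_total ‖auxX J μ c t‖ r with h | h
        · have h2 : p * ‖auxX J μ c t‖ ≤ p * r := by gcongr
          have := hN0 (auxX J μ c t)
          linarith
        · have := aux_lin_lower (fun x => F x - a / 2 * ‖x‖ ^ 2) hN (by simp [hF0]) (ω - a) r hr
            (by intro x hx; have := hloc x hx; linarith) (auxX J μ c t) h
          have h2 : 0 ≤ p * r := by positivity
          have h3 : p * ‖auxX J μ c t‖ ≤ F (auxX J μ c t) - a / 2 * ‖auxX J μ c t‖ ^ 2 := this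
          linarith
    rw [intervalIntegral.integral_sub (by apply Continuous.intervalIntegrable; fun_prop)
      (by apply Continuous.intervalIntegrable; fun_prop), intervalIntegral.integral_const_mul,
      intervalIntegral.integral_const, smul_eq_mul] at h1
    rw [hC₃, le_div_iff₀ hp0]
    have : 0 ≤ π * Y := by positivity
    linarith
  have g2 : ‖c (Sum.inl i₀)‖ ≤ C₃ / (2 * π) := by
    have h1 := auxX_integral J hJ2 hJs μ hμ c (Pi.single (Sum.inl i₀) (c (Sum.inl i₀)))
    rw [Finset.sum_eq_single (Sum.inl i₀) (by
      intro j _ hj; rw [Pi.single_eq_of_ne hj, inner_zero_right]) (by simp), Pi.single_eq_same,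
      real_inner_self_eq_norm_sq] at h1
    have h2 : ∫ t in (0 : ℝ)..(2 * π), ⟪auxX J μ c t, auxX J μ (Pi.single (Sum.inl i₀) (c (Sum.inl i₀))) t⟫
        ≤ ∫ t in (0 : ℝ)..(2 * π), ‖auxX J μ c t‖ * ‖c (Sum.inl i₀)‖ := by
      have := auxX_continuous' J μ (Pi.single (Sum.inl i₀) (c (Sum.inl i₀)))
      apply intervalIntegral.integral_mono_on (by positivity)
      · apply Continuous.intervalIntegrable; fun_prop
      · apply Continuous.intervalIntegrable; fun_prop
      · intro t _
        refine (real_inner_le_norm _ _).trans ?_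
        rw [auxX_single, auxR_norm J hJ2 hJs]
    rw [h1, intervalIntegral.integral_mul_const] at h2
    rw [le_div_iff₀ (by positivity)]
    by_cases h0 : ‖c (Sum.inl i₀)‖ = 0
    · rw [h0, zero_mul]
      refine le_trans ?_ g1
      exact intervalIntegral.integral_nonneg (by positivity) fun t _ => norm_nonneg _
    · have h3 : 0 < ‖c (Sum.inl i₀)‖ := lt_of_le_of_ne (norm_nonneg _) (Ne.symm h0)
      have h4 : ‖c (Sum.inl i₀)‖ * (‖c (Sum.inl i₀)‖ * (2 * π)) ≤ ‖c (Sum.inl i₀)‖ * C₃ := by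
        have h5 : (∫ t in (0 : ℝ)..(2 * π), ‖auxX J μ c t‖) * ‖c (Sum.inl i₀)‖ ≤ C₃ * ‖c (Sum.inl i₀)‖ := by
          gcongr
        linarith
      exact le_of_mul_le_mul_left h4 h3
  have g3 : ∑ i, ‖c (Sum.inl i)‖ ^ 2 ≤ Y + (C₃ / (2 * π)) ^ 2 := by
    have : ∑ i, ‖c (Sum.inl i)‖ ^ 2 ≤ ∑ i, ((a - lam (Sum.inl i)) * ‖c (Sum.inl i)‖ ^ 2
        + if i = i₀ then (C₃ / (2 * π)) ^ 2 else 0) := by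
      apply Finset.sum_le_sum
      intro i _
      split_ifs with h
      · subst h
        have h1 : ‖c (Sum.inl i)‖ ^ 2 ≤ (C₃ / (2 * π)) ^ 2 := by gcongr
        have h2 : 0 ≤ (a - lam (Sum.inl i)) * ‖c (Sum.inl i)‖ ^ 2 :=
          mul_nonneg (by linarith [hl1 i]) (by positivity)
        linarith
      · have := hl1' i h
        have h3 : 0 ≤ (a - 1 - lam (Sum.inl i)) * ‖c (Sum.inl i)‖ ^ 2 :=
          mul_nonneg (by linarith) (by positivity)
        linarith
    rw [Finset.sum_add_distrib, Finset.sum_ite_eq' ] at this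
    simpa using this
  rw [Fintype.sum_sum_type]
  linarith

variable [FiniteDimensional ℝ E] [Nontrivial E]

set_option maxHeartbeats 1000000 in
theorem aux_uniform (J : E →L[ℝ] E) (hJ2 : ∀ v, J (J v) = -v) (hJs : ∀ u v : E, ⟪J u, v⟫ = -⟪u, J v⟫)
    (F : E → ℝ) (f : E → E) (hF : Continuous F) (hf : Continuous f)
    (hgrad : ∀ x y, F x + ⟪f x, y - x⟫ ≤ F y)
    (a b k c₀ ω r : ℝ) (hak : a ≤ k) (hbk : b < k) (hkω : k < ω) (hr : 0 < r)
    (hN : ConvexOn ℝ Set.univ fun x => F x - a / 2 * ‖x‖ ^ 2)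
    (hN0 : ∀ x, 0 ≤ F x - a / 2 * ‖x‖ ^ 2) (hFn : ∀ x, 0 ≤ F x)
    (hF0 : F 0 = 0) (hup : ∀ x, F x ≤ b / 2 * ‖x‖ ^ 2 + c₀)
    (hloc : ∀ x, ‖x‖ ≤ r → ω / 2 * ‖x‖ ^ 2 ≤ F x) :
    ∃ C δ : ℝ, 0 < δ ∧ ∀ (ι κ : Type) [Fintype ι] [Fintype κ] (μ : ι ⊕ κ → ℤ) (lam : ι ⊕ κ → ℝ)
      (ε : ℝ) (i₀ : ι) (j₀ : κ), Function.Injective μ → 0 < ε → ε ≤ 1 →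
      (∀ i, lam (Sum.inl i) ≤ a - ε) → (∀ i, i ≠ i₀ → lam (Sum.inl i) ≤ a - 1) →
      (∀ j, k ≤ lam (Sum.inr j)) → lam (Sum.inr j₀) = k → (∀ i, |lam i - μ i| ≤ ε) →
      ∃ c : ι ⊕ κ → E,
        (∫ t in (0 : ℝ)..(2 * π), ‖auxX J μ c t‖ ^ 2 ≤ C) ∧
        (∫ t in (0 : ℝ)..(2 * π), ‖auxX J μ (fun i => (μ i : ℝ) • J (c i)) t‖ ^ 2 ≤ C) ∧
        (∀ i e, |(∫ t in (0 : ℝ)..(2 * π), ⟪f (auxX J μ c t), auxR J (μ i * t) e⟫)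
          - μ i * ∫ t in (0 : ℝ)..(2 * π), ⟪auxX J μ c t, auxR J (μ i * t) e⟫| ≤ C * ‖e‖ * ε) ∧
        (∫ t in (0 : ℝ)..(2 * π), (1 / 2 * ⟪f (auxX J μ c t), auxX J μ c t⟫ - F (auxX J μ c t))) ≤ - δ := by
  have hpi := pi_pos
  have haω : a < ω := by linarith
  obtain ⟨e₀, he₀⟩ := exists_norm_eq E (zero_le_one' ℝ)
  obtain ⟨C₁, hC₁⟩ : ∃ C₁ : ℝ, C₁ = 2 * c₀ / (k - b) := ⟨_, rfl⟩
  obtain ⟨C₂, hC₂⟩ : ∃ C₂ : ℝ, C₂ = 4 * c₀ + |b - a| * C₁ := ⟨_, rfl⟩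
  obtain ⟨C₃, hC₃⟩ : ∃ C₃ : ℝ, C₃ = (π * C₂ + 2 * π * ((ω - a) * r / 2 * r)) / ((ω - a) * r / 2) := ⟨_, rfl⟩
  set C₄ : ℝ := C₂ + (C₃ / (2 * π)) ^ 2 + C₁ with hC₄
  set K : ℝ := 2 * |b| + |c₀| with hK
  set C₅ : ℝ := 2 * π * (2 * K ^ 2) * (1 + C₄) with hC₅
  refine ⟨2 * C₅ + 4 * π * (1 + C₄), π * (r / 2) ^ 2 * (ω - k), by
    have : 0 < ω - k := by linarith
    positivity, ?_⟩
  intro ι κ _ _ μ lam ε i₀ j₀ hμ hε hε1 hl1 hl1' hl2 hj₀ hlm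
  classical
  obtain ⟨c, hcr, hmin, hmax⟩ := aux_galerkin J hJ2 hJs μ hμ lam F f hF hf hgrad a b k c₀ ε hε hak hbk
    hl1 hl2 hN hN0 hup
  have hl1a : ∀ i, lam (Sum.inl i) ≤ a := fun i => by linarith [hl1 i]
  have hδ : auxPhi J μ lam F c ≤ π * (r / 2) ^ 2 * (k - ω) := by
    obtain ⟨z, hz⟩ := aux_delta J hJ2 hJs μ hμ lam F hF a k ω r haω hr hl1a j₀ hj₀ hN hF0 hloc e₀ he₀
    obtain ⟨y, hy⟩ := hmin z
    exact hy.trans (hz y)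
  have hneg : auxPhi J μ lam F c ≤ 0 := by
    refine hδ.trans ?_
    exact mul_nonpos_of_nonneg_of_nonpos (by positivity) (by linarith)
  have hl2b : ∑ i, ‖c i‖ ^ 2 ≤ C₄ := aux_l2_bound J hJ2 hJs μ hμ lam F hF a b k c₀ ω r hbk haω hr i₀
    hl1a hl1' hl2 hN hN0 hF0 hup hloc C₁ C₂ C₃ hC₁ hC₂ hC₃ c hmax hneg
  have hC₄0 : 0 ≤ C₄ := le_trans (Finset.sum_nonneg fun i _ => by positivity) hl2b
  have hC₅0 : 0 ≤ C₅ := by positivity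
  have hXc := auxX_continuous' J μ c
  have hX2 := auxX_integral_sq J hJ2 hJs μ hμ c
  have hR : ∀ (m : ℤ) e, Continuous fun t : ℝ => auxR J (m * t) e := fun m e => by
    unfold auxR; fun_prop
  have hall : ∀ d : ι ⊕ κ → E, 2 * π * ∑ i, lam i * ⟪c i, d i⟫
      = ∫ t in (0 : ℝ)..(2 * π), ⟪f (auxX J μ c t), auxX J μ d t⟫ := by
    intro d
    rw [Finset.mul_sum]
    simp only [hcr]
    rw [← intervalIntegral.integral_finsetSum]
    · simp only [← inner_sum]
      rfl
    · intro i _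
      exact ((hf.comp hXc).inner (hR _ _)).intervalIntegrable _ _
  -- derivative bound
  have hY : 2 * π * ∑ i, lam i ^ 2 * ‖c i‖ ^ 2 ≤ C₅ := by
    set d : ι ⊕ κ → E := fun i => lam i • c i with hd
    have hXd := auxX_continuous' J μ d
    have h1 := hall d
    have h2 := auxX_integral_sq J hJ2 hJs μ hμ d
    have h3 : ∑ i, lam i * ⟪c i, d i⟫ = ∑ i, lam i ^ 2 * ‖c i‖ ^ 2 := by
      apply Finset.sum_congr rfl
      intro i _
      simp only [hd, inner_smul_right, real_inner_self_eq_norm_sq]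
      ring
    have h4 : ∑ i, ‖d i‖ ^ 2 = ∑ i, lam i ^ 2 * ‖c i‖ ^ 2 := by
      apply Finset.sum_congr rfl
      intro i _
      simp only [hd, norm_smul, mul_pow, Real.norm_eq_abs, sq_abs]
    rw [h3] at h1
    rw [h4] at h2
    have h5 : ∫ t in (0 : ℝ)..(2 * π), ⟪f (auxX J μ c t), auxX J μ d t⟫
        ≤ ∫ t in (0 : ℝ)..(2 * π), (K ^ 2 + K ^ 2 * ‖auxX J μ c t‖ ^ 2 + 1 / 2 * ‖auxX J μ d t‖ ^ 2) := by
      apply intervalIntegral.integral_mono_on (by positivity)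
      · apply Continuous.intervalIntegrable; fun_prop
      · apply Continuous.intervalIntegrable; fun_prop
      · intro t _
        have g1 := real_inner_le_norm (f (auxX J μ c t)) (auxX J μ d t)
        have g2 := aux_growth F f hgrad hFn b c₀ hup (auxX J μ c t)
        rw [← hK] at g2
        have g3 : ‖f (auxX J μ c t)‖ ^ 2 ≤ (K * (1 + ‖auxX J μ c t‖)) ^ 2 := by gcongr
        have g4 : (K * (1 + ‖auxX J μ c t‖)) ^ 2 ≤ 2 * (K ^ 2 + K ^ 2 * ‖auxX J μ c t‖ ^ 2) := by
          have : 0 ≤ K ^ 2 * (1 - ‖auxX J μ c t‖) ^ 2 := by positivity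
          have g5 : 2 * (K ^ 2 + K ^ 2 * ‖auxX J μ c t‖ ^ 2) - (K * (1 + ‖auxX J μ c t‖)) ^ 2
            = K ^ 2 * (1 - ‖auxX J μ c t‖) ^ 2 := by ring
          linarith
        have g6 := two_mul_le_add_sq ‖f (auxX J μ c t)‖ ‖auxX J μ d t‖
        linarith
    have i1 : Continuous fun t => K ^ 2 + K ^ 2 * ‖auxX J μ c t‖ ^ 2 := by fun_prop
    have i2 : Continuous fun t => 1 / 2 * ‖auxX J μ d t‖ ^ 2 := by fun_prop
    have i3 : Continuous fun t => K ^ 2 * ‖auxX J μ c t‖ ^ 2 := by fun_prop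
    have i4 : Continuous fun _ : ℝ => K ^ 2 := by fun_prop
    rw [intervalIntegral.integral_add (i1.intervalIntegrable _ _) (i2.intervalIntegrable _ _),
      intervalIntegral.integral_add (i4.intervalIntegrable _ _) (i3.intervalIntegrable _ _),
      intervalIntegral.integral_const_mul, intervalIntegral.integral_const_mul,
      intervalIntegral.integral_const, smul_eq_mul, h2, hX2, ← h1] at h5
    have h6 : 2 * π * K ^ 2 * ∑ i, ‖c i‖ ^ 2 ≤ 2 * π * K ^ 2 * C₄ := by gcongr
    rw [hC₅]
    linarith
  refine ⟨c, ?_, ?_, ?_, ?_⟩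
  · rw [hX2]
    have : 2 * π * ∑ i, ‖c i‖ ^ 2 ≤ 2 * π * C₄ := by gcongr
    have h0 : 0 ≤ π * C₄ := by positivity
    linarith
  · rw [auxX_integral_sq J hJ2 hJs μ hμ]
    have h1 : ∑ i, ‖(μ i : ℝ) • J (c i)‖ ^ 2 ≤ ∑ i, (2 * (lam i ^ 2 * ‖c i‖ ^ 2) + 2 * ‖c i‖ ^ 2) := by
      apply Finset.sum_le_sum
      intro i _
      have hJn : ‖J (c i)‖ ^ 2 = ‖c i‖ ^ 2 := by
        rw [← real_inner_self_eq_norm_sq, hJs, hJ2, inner_neg_right, neg_neg, real_inner_self_eq_norm_sq]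
      rw [norm_smul, mul_pow, hJn, Real.norm_eq_abs, sq_abs]
      have h2 : (lam i - μ i) ^ 2 ≤ 1 := by
        rw [← sq_abs]
        have := hlm i
        have h3 := abs_nonneg (lam i - μ i)
        exact pow_le_one₀ h3 (by linarith)
      have h3 : (μ i : ℝ) ^ 2 ≤ 2 * lam i ^ 2 + 2 := by 
        have h6 : (lam i - μ i) ^ 2 * 2 - μ i ^ 2 + 2 * lam i ^ 2 = (2 * lam i - μ i) ^ 2 := by ring
        have := sq_nonneg (2 * lam i - μ i)
        linarith
      have h7 : (μ i : ℝ) ^ 2 * ‖c i‖ ^ 2 ≤ (2 * lam i ^ 2 + 2) * ‖c i‖ ^ 2 := by gcongr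
      linarith
    rw [Finset.sum_add_distrib, ← Finset.mul_sum, ← Finset.mul_sum] at h1
    have h4 : 2 * π * ∑ i, ‖(μ i : ℝ) • J (c i)‖ ^ 2
      ≤ 2 * π * (2 * ∑ i, lam i ^ 2 * ‖c i‖ ^ 2 + 2 * ∑ i, ‖c i‖ ^ 2) := by gcongr
    have h5 : 2 * π * ∑ i, ‖c i‖ ^ 2 ≤ 2 * π * C₄ := by gcongr
    have h0 : 0 ≤ π * C₄ := by positivity
    linarith
  · intro i e
    have h1 := hcr i e
    have h2 := auxX_integral J hJ2 hJs μ hμ c (Pi.single i e)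
    simp only [auxX_single] at h2
    rw [Finset.sum_eq_single i (by
      intro j _ hj; rw [Pi.single_eq_of_ne hj, inner_zero_right]) (by simp), Pi.single_eq_same] at h2
    rw [← h1, h2]
    have h3 : 2 * π * (lam i * ⟪c i, e⟫) - μ i * (2 * π * ⟪c i, e⟫) = 2 * π * ((lam i - μ i) * ⟪c i, e⟫) := by ring
    rw [h3, abs_mul (2 * π), abs_of_pos (by positivity : 0 < 2 * π), abs_mul]
    have h4 := abs_real_inner_le_norm (c i) e
    have h5 : ‖c i‖ ^ 2 ≤ C₄ := le_trans
      (Finset.single_le_sum (f := fun i => ‖c i‖ ^ 2) (fun i _ => by positivity) (Finset.mem_univ i)) hl2b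
    have h6 : ‖c i‖ ≤ 1 + C₄ := by nlinarith [sq_nonneg (‖c i‖ - 1)]
    have h7 : |lam i - μ i| * |⟪c i, e⟫| ≤ ε * ((1 + C₄) * ‖e‖) := by
      apply mul_le_mul (hlm i) _ (abs_nonneg _) hε.le
      refine h4.trans ?_
      gcongr
    have h8 : 0 ≤ ε * ((1 + C₄) * ‖e‖) := by positivity
    have h9 : 0 ≤ C₅ * ‖e‖ * ε := by positivity
    have h10 : 2 * π * (|lam i - μ i| * |⟪c i, e⟫|) ≤ 2 * π * (ε * ((1 + C₄) * ‖e‖)) := by gcongr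
    have h11 : 0 ≤ π * (ε * ((1 + C₄) * ‖e‖)) := by positivity
    linarith
  · have h1 := hall c
    simp only [real_inner_self_eq_norm_sq] at h1
    rw [intervalIntegral.integral_sub (by apply Continuous.intervalIntegrable; fun_prop)
      (by apply Continuous.intervalIntegrable; fun_prop), intervalIntegral.integral_const_mul, ← h1]
    unfold auxPhi at hδ
    linarith

theorem aux_core (J : E →L[ℝ] E) (hJ2 : ∀ v, J (J v) = -v) (hJs : ∀ u v : E, ⟪J u, v⟫ = -⟪u, J v⟫)
    (F : E → ℝ) (f : E → E) (hF : Continuous F) (hf : Continuous f)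
    (hgrad : ∀ x y, F x + ⟪f x, y - x⟫ ≤ F y)
    (k : ℤ) (b c₀ ω r : ℝ) (hbk : b < k) (hkω : k < ω) (hr : 0 < r)
    (hN : ConvexOn ℝ Set.univ fun x => F x - ((k : ℝ) - 1) / 2 * ‖x‖ ^ 2)
    (hN0 : ∀ x, 0 ≤ F x - ((k : ℝ) - 1) / 2 * ‖x‖ ^ 2) (hFn : ∀ x, 0 ≤ F x)
    (hF0 : F 0 = 0) (hup : ∀ x, F x ≤ b / 2 * ‖x‖ ^ 2 + c₀)
    (hloc : ∀ x, ‖x‖ ≤ r → ω / 2 * ‖x‖ ^ 2 ≤ F x) :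
    ∃ y : ℝ → E, (∀ t, y (t + 2 * π) = y t) ∧ (∀ t, HasDerivAt y (J (f (y t))) t) ∧
      ∃ t₁ t₂, y t₁ ≠ y t₂ := by
  obtain ⟨C, δ, hδ, hun⟩ := aux_uniform J hJ2 hJs F f hF hf hgrad ((k : ℝ) - 1) b k c₀ ω r (by linarith) hbk hkω hr
    hN hN0 hFn hF0 hup hloc
  have key : ∀ j : ℕ, ∃ x x' : ℝ → E, (∀ t, x (t + 2 * π) = x t) ∧ (∀ t, HasDerivAt x (x' t) t) ∧
      Continuous x' ∧ (∫ t in (0 : ℝ)..(2 * π), ‖x' t‖ ^ 2 ≤ C) ∧ (∀ t, x' (t + 2 * π) = x' t) ∧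
      (∫ t in (0 : ℝ)..(2 * π), ‖x t‖ ^ 2 ≤ C) ∧
      (∀ m : ℤ, |m| ≤ j → ∀ e : E, |(∫ t in (0 : ℝ)..(2 * π), ⟪f (x t), auxR J (m * t) e⟫)
        - m * ∫ t in (0 : ℝ)..(2 * π), ⟪x t, auxR J (m * t) e⟫| ≤ C * ‖e‖ * (1 / ((j : ℝ) + 1))) ∧
      (∫ t in (0 : ℝ)..(2 * π), (1 / 2 * ⟪f (x t), x t⟫ - F (x t))) ≤ - δ := by
    intro j
    obtain ⟨M, hM⟩ : ∃ M : ℤ, M = j + |k| + 1 := ⟨_, rfl⟩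
    have hk1 := neg_abs_le k
    have hk2 := le_abs_self k
    set ε : ℝ := 1 / ((j : ℝ) + 1) with hε
    have hε0 : 0 < ε := by positivity
    have hε1 : ε ≤ 1 := by
      rw [hε, div_le_one (by positivity)]
      have : (0 : ℝ) ≤ j := by positivity
      linarith
    let ι : Type := {m : ℤ // m ∈ Finset.Icc (-M) (k - 1)}
    let κ : Type := {m : ℤ // m ∈ Finset.Icc k M}
    let : Fintype ι := inferInstanceAs (Fintype {m : ℤ // m ∈ Finset.Icc (-M) (k - 1)})
    let : Fintype κ := inferInstanceAs (Fintype {m : ℤ // m ∈ Finset.Icc k M})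
    let i₀ : ι := ⟨k - 1, by rw [Finset.mem_Icc]; omega⟩
    let j₀ : κ := ⟨k, by rw [Finset.mem_Icc]; omega⟩
    let μ : ι ⊕ κ → ℤ := Sum.elim (fun i => i.1) (fun i => i.1)
    let lam : ι ⊕ κ → ℝ := Sum.elim (fun i => (i.1 : ℝ) - ε) (fun i => (i.1 : ℝ))
    have hι : ∀ i : ι, -M ≤ i.1 ∧ i.1 ≤ k - 1 := fun i => Finset.mem_Icc.mp i.2
    have hκ : ∀ i : κ, k ≤ i.1 ∧ i.1 ≤ M := fun i => Finset.mem_Icc.mp i.2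
    have hμ : Function.Injective μ := by
      rintro (x | x) (y | y) h
      · exact congrArg Sum.inl (Subtype.ext h)
      · have h1 := hι x
        have h2 := hκ y
        simp only [μ, Sum.elim_inl, Sum.elim_inr] at h
        omega
      · have h1 := hι y
        have h2 := hκ x
        simp only [μ, Sum.elim_inl, Sum.elim_inr] at h
        omega
      · exact congrArg Sum.inr (Subtype.ext h)
    obtain ⟨c, hc1, hc2, hc3, hc4⟩ := hun ι κ μ lam ε i₀ j₀ hμ hε0 hε1
      (by
        intro i
        have : ((i.1 : ℤ) : ℝ) ≤ k - 1 := by exact_mod_cast (hι i).2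
        simp only [lam, Sum.elim_inl]; linarith)
      (by
        intro i hi
        have h1 : i.1 ≠ k - 1 := fun h => hi (Subtype.ext h)
        have h2 : i.1 ≤ k - 1 - 1 := by have := (hι i).2; omega
        have : ((i.1 : ℤ) : ℝ) ≤ k - 1 - 1 := by exact_mod_cast h2
        simp only [lam, Sum.elim_inl]; linarith)
      (by
        intro i
        simp only [lam, Sum.elim_inr]; exact_mod_cast (hκ i).1)
      (by simp only [lam, Sum.elim_inr, j₀])
      (by
        rintro (i | i)
        · simp only [lam, μ, Sum.elim_inl, sub_sub_cancel_left, abs_neg, abs_of_pos hε0, le_refl]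
        · simp only [lam, μ, Sum.elim_inr, sub_self, abs_zero]; exact hε0.le)
    refine ⟨auxX J μ c, auxX J μ (fun i => (μ i : ℝ) • J (c i)), auxX_periodic J μ c,
      auxX_hasDerivAt J hJ2 μ c, auxX_continuous' J μ _, hc2, auxX_periodic J μ _, hc1, ?_, hc4⟩
    intro m hm e
    have hm' := abs_le.mp hm
    obtain ⟨i, rfl⟩ : ∃ i, μ i = m := by
      rcases lt_or_ge m k with h | h
      · exact ⟨Sum.inl ⟨m, by rw [Finset.mem_Icc]; omega⟩, rfl⟩
      · exact ⟨Sum.inr ⟨m, by rw [Finset.mem_Icc]; omega⟩, rfl⟩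
    exact hc3 i e
  choose x x' h1 h2 h3 h4 h5 h6 h7 h8 using key
  obtain ⟨y, hy1, hy2, hy3⟩ := aux_limit J hJ2 hJs F f hF hf C δ x x' h1 h2 h3 h4 h5 h6
    (by
      intro m
      refine ⟨m.natAbs, fun j hj e => h7 j m ?_ e⟩
      rw [Int.abs_eq_natAbs]
      exact_mod_cast hj) h8
  refine ⟨y, hy1, hy2, ?_⟩
  by_contra! hcon
  have hy : ∀ t, y t = y 0 := fun t => hcon t 0
  have e1 : HasDerivAt y 0 0 := by
    have : y = fun _ => y 0 := funext hy
    rw [this]; exact hasDerivAt_const _ _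
  have e2 : J (f (y 0)) = 0 := (hy2 0).unique e1
  have e3 : f (y 0) = 0 := by
    have := hJ2 (f (y 0))
    rw [e2, map_zero] at this
    exact neg_eq_zero.mp this.symm
  have e4 : F (y 0) = 0 := by
    have := hgrad (y 0) 0
    rw [e3, inner_zero_left, add_zero, hF0] at this
    exact le_antisymm this (hFn _)
  simp only [hy, e4, e3, inner_zero_left, mul_zero, sub_zero, intervalIntegral.integral_zero] at hy3
  linarith

end uniform

section reduction

theorem aux_gradient_ineq {E : Type*} [NormedAddCommGroup E] [NormedSpace ℝ E] (g : E → ℝ)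
    (hg : ConvexOn ℝ Set.univ g) (x y : E) (g' : E →L[ℝ] ℝ) (h : HasFDerivAt g g' x) :
    g x + g' (y - x) ≤ g y := by
  have h1 : ConvexOn ℝ Set.univ (fun t : ℝ => g (x + t • (y - x))) := by
    refine ⟨convex_univ, fun s _ t _ p q hp hq hpq => ?_⟩
    have h2 := hg.2 (Set.mem_univ (x + s • (y - x))) (Set.mem_univ (x + t • (y - x))) hp hq hpq
    have h3 : x + (p • s + q • t) • (y - x) = p • (x + s • (y - x)) + q • (x + t • (y - x)) := by
      have : x = (p + q) • x := by rw [hpq, one_smul]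
      nth_rewrite 1 [this]
      simp only [smul_eq_mul]
      module
    simp only [h3]
    exact h2
  have h2 : HasDerivAt (fun t : ℝ => g (x + t • (y - x))) (g' (y - x)) 0 := by
    have e1 : HasDerivAt (fun t : ℝ => x + t • (y - x)) (y - x) 0 := by
      simpa using ((hasDerivAt_id (0 : ℝ)).smul_const (y - x)).const_add x
    have e2 : HasFDerivAt g g' (x + (0 : ℝ) • (y - x)) := by simpa using h
    exact e2.comp_hasDerivAt (0 : ℝ) e1
  have h3 := h1.le_slope_of_hasDerivAt (Set.mem_univ 0) (Set.mem_univ 1) one_pos h2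
  simp only [slope, zero_smul, add_zero, one_smul, add_sub_cancel, sub_zero, inv_one, vsub_eq_sub] at h3
  linarith

theorem aux_local_lower {E : Type*} [NormedAddCommGroup E] [NormedSpace ℝ E] (H : E → ℝ) (hH : ContDiff ℝ 2 H)
    (ξ : E) (h0 : fderiv ℝ H ξ = 0) (w w' : ℝ) (hw : w' < w)
    (hq : ∀ v, w * ‖v‖ ^ 2 ≤ fderiv ℝ (fderiv ℝ H) ξ v v) :
    ∃ r, 0 < r ∧ ∀ x, ‖x‖ ≤ r → w' / 2 * ‖x‖ ^ 2 ≤ H (ξ + x) - H ξ := by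
  have hd1 : Differentiable ℝ H := hH.differentiable (by norm_num)
  have hd2 : Differentiable ℝ (fderiv ℝ H) :=
    (hH.fderiv_right (m := 1) (by norm_num)).differentiable (by norm_num)
  have h1 := (hd2 ξ).hasFDerivAt.isLittleO
  have h2 := h1.def (by linarith : 0 < w - w')
  obtain ⟨r, hr, hb⟩ := Metric.eventually_nhds_iff_ball.mp h2
  refine ⟨r / 2, by positivity, fun x hx => ?_⟩
  set φ : ℝ → ℝ := fun t => H (ξ + t • x) - w' / 2 * ‖x‖ ^ 2 * t ^ 2 with hφ
  have hφd : ∀ t, HasDerivAt φ (fderiv ℝ H (ξ + t • x) x - w' / 2 * ‖x‖ ^ 2 * (2 * t)) t := by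
    intro t
    have e1 : HasDerivAt (fun t : ℝ => ξ + t • x) x t := by
      simpa using ((hasDerivAt_id t).smul_const x).const_add ξ
    have e2 := (hd1 (ξ + t • x)).hasFDerivAt.comp_hasDerivAt t e1
    have e3 : HasDerivAt (fun t : ℝ => w' / 2 * ‖x‖ ^ 2 * t ^ 2) (w' / 2 * ‖x‖ ^ 2 * (2 * t)) t := by
      simpa using (hasDerivAt_pow 2 t).const_mul (w' / 2 * ‖x‖ ^ 2)
    exact e2.sub e3
  have hmono : MonotoneOn φ (Set.Icc 0 1) := by
    apply monotoneOn_of_deriv_nonneg (convex_Icc 0 1)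
    · exact fun t _ => (hφd t).continuousAt.continuousWithinAt
    · exact fun t _ => (hφd t).differentiableAt.differentiableWithinAt
    · intro t ht
      rw [interior_Icc] at ht
      rw [(hφd t).deriv]
      have hn : ‖t • x‖ = t * ‖x‖ := by rw [norm_smul, Real.norm_eq_abs, abs_of_pos ht.1]
      have e1 := hb (ξ + t • x) (by
        rw [Metric.mem_ball, dist_eq_norm, add_sub_cancel_left, hn]
        have : t * ‖x‖ ≤ 1 * ‖x‖ := by gcongr; exact ht.2.le
        linarith)
      rw [h0, sub_zero, add_sub_cancel_left, hn] at e1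
      have e2 := (fderiv ℝ H (ξ + t • x) - fderiv ℝ (fderiv ℝ H) ξ (t • x)).le_opNorm x
      have e3 : -((w - w') * (t * ‖x‖) * ‖x‖) ≤
          (fderiv ℝ H (ξ + t • x) - fderiv ℝ (fderiv ℝ H) ξ (t • x)) x := by
        rw [Real.norm_eq_abs] at e2
        have e4 := neg_abs_le ((fderiv ℝ H (ξ + t • x) - fderiv ℝ (fderiv ℝ H) ξ (t • x)) x)
        have e5 : ‖fderiv ℝ H (ξ + t • x) - fderiv ℝ (fderiv ℝ H) ξ (t • x)‖ * ‖x‖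
          ≤ (w - w') * (t * ‖x‖) * ‖x‖ := by gcongr
        linarith
      rw [sub_apply, map_smul, smul_apply, smul_eq_mul] at e3
      have e6 : t * (w * ‖x‖ ^ 2) ≤ t * fderiv ℝ (fderiv ℝ H) ξ x x :=
        mul_le_mul_of_nonneg_left (hq x) ht.1.le
      linarith
  have := hmono (Set.left_mem_Icc.mpr zero_le_one) (Set.right_mem_Icc.mpr zero_le_one) zero_le_one
  simp only [hφ, zero_smul, add_zero, one_smul] at this
  linarith

theorem aux_hessian {m : ℕ} (H : EuclideanSpace ℝ (Fin m) → ℝ) (hH : ContDiff ℝ 2 H)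
    (ξ : EuclideanSpace ℝ (Fin m)) (w : ℝ)
    (hw : ∀ μ : ℝ, (∃ v : Fin m → ℝ, v ≠ 0 ∧ (hessianMatrix H ξ).mulVec v = μ • v) → w ≤ μ)
    (v : EuclideanSpace ℝ (Fin m)) : w * ‖v‖ ^ 2 ≤ fderiv ℝ (fderiv ℝ H) ξ v v := by
  classical
  set A := hessianMatrix H ξ with hA
  have hAe : ∀ i j, A i j = fderiv ℝ (fderiv ℝ H) ξ (EuclideanSpace.single i 1) (EuclideanSpace.single j 1) := by
    intro i j
    simp only [hA, hessianMatrix, Matrix.of_apply, iteratedFDeriv_two_apply]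
    rfl
  have hsym : IsSymmSndFDerivAt ℝ H ξ := hH.contDiffAt.isSymmSndFDerivAt (by simp)
  have hAh : (A - w • (1 : Matrix (Fin m) (Fin m) ℝ)).IsHermitian := by
    apply Matrix.IsHermitian.sub
    · ext i j
      rw [Matrix.conjTranspose_apply, star_trivial, hAe, hAe]
      exact hsym _ _
    · apply Matrix.IsHermitian.ext
      intro i j
      simp [Matrix.one_apply, eq_comm]
  have hps : (A - w • (1 : Matrix (Fin m) (Fin m) ℝ)).PosSemidef := by
    rw [hAh.posSemidef_iff_eigenvalues_nonneg]
    intro j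
    have h1 := hAh.mulVec_eigenvectorBasis j
    rw [Matrix.sub_mulVec, Matrix.smul_mulVec, Matrix.one_mulVec, sub_eq_iff_eq_add, ← add_smul] at h1
    have h2 := hw _ ⟨_, ?_, h1⟩
    · simpa using h2
    · intro h
      have := hAh.eigenvectorBasis.orthonormal.ne_zero j
      exact this (by ext i; exact congrFun h i)
  have h1 := hps.dotProduct_mulVec_nonneg v.ofLp
  rw [Matrix.sub_mulVec, Matrix.smul_mulVec, Matrix.one_mulVec, star_trivial, dotProduct_sub,
    dotProduct_smul] at h1
  have h2 : v.ofLp ⬝ᵥ v.ofLp = ‖v‖ ^ 2 := by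
    rw [EuclideanSpace.real_norm_sq_eq, dotProduct]
    apply Finset.sum_congr rfl
    intro i _
    ring
  have h3 : v = ∑ i, v i • EuclideanSpace.single i (1 : ℝ) := by
    ext j
    simp [Finset.sum_apply, Pi.single_apply]
  have h4 : fderiv ℝ (fderiv ℝ H) ξ v v = v.ofLp ⬝ᵥ A.mulVec v.ofLp := by
    conv_lhs => rw [h3]
    simp only [map_sum, map_smul, sum_apply, smul_apply,
      dotProduct, Matrix.mulVec, hAe, smul_eq_mul, Finset.mul_sum]
    rw [Finset.sum_comm]
    apply Finset.sum_congr rfl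
    intro i _
    apply Finset.sum_congr rfl
    intro j _
    ring
  rw [h2, smul_eq_mul] at h1
  linarith

theorem aux_J_sq (n : ℕ) : symplecticJ n * symplecticJ n = -1 := by
  unfold symplecticJ
  rw [Matrix.reindex_apply, Matrix.submatrix_mul_equiv, Matrix.fromBlocks_multiply]
  simp only [mul_zero, mul_neg, mul_one, zero_add, add_zero, neg_zero]
  have : (Matrix.fromBlocks (-1) 0 0 (-1) : Matrix (Fin n ⊕ Fin n) (Fin n ⊕ Fin n) ℝ) = -1 := by
    rw [← Matrix.fromBlocks_one, Matrix.fromBlocks_neg]; simp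
  rw [this]
  ext i j
  simp [Matrix.one_apply]

theorem aux_J_transpose (n : ℕ) : (symplecticJ n).transpose = - symplecticJ n := by
  unfold symplecticJ
  rw [Matrix.reindex_apply, Matrix.transpose_submatrix, Matrix.fromBlocks_transpose]
  ext i j
  rw [Matrix.neg_apply, Matrix.submatrix_apply, Matrix.submatrix_apply, ← Matrix.neg_apply, Matrix.fromBlocks_neg]
  simp

theorem aux_J_clm (n : ℕ) : ∃ J : EuclideanSpace ℝ (Fin (2*n)) →L[ℝ] EuclideanSpace ℝ (Fin (2*n)),
    (∀ v, (J v).ofLp = (symplecticJ n).mulVec v.ofLp) ∧ (∀ v, J (J v) = -v) ∧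
      ∀ u v : EuclideanSpace ℝ (Fin (2*n)), ⟪J u, v⟫ = -⟪u, J v⟫ := by
  have h0 : ∀ v, ((Matrix.toEuclideanCLM (𝕜 := ℝ) (symplecticJ n)) v).ofLp = (symplecticJ n).mulVec v.ofLp :=
    fun v => Matrix.ofLp_toEuclideanCLM _ _
  refine ⟨Matrix.toEuclideanCLM (𝕜 := ℝ) (symplecticJ n), h0, ?_, ?_⟩
  · intro v
    apply WithLp.ofLp_injective 2
    rw [h0, h0, Matrix.mulVec_mulVec, aux_J_sq, Matrix.neg_mulVec, Matrix.one_mulVec]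
    rfl
  · intro u v
    rw [real_inner_comm, Matrix.inner_toEuclideanCLM, Matrix.inner_toEuclideanCLM]
    rw [Matrix.dotProduct_mulVec, ← Matrix.mulVec_transpose, aux_J_transpose, Matrix.neg_mulVec, neg_dotProduct,
      dotProduct_comm]

theorem aux_convex_shift {E : Type*} [NormedAddCommGroup E] [InnerProductSpace ℝ E] (H : E → ℝ) (a θ p d : ℝ)
    (hθ : 0 ≤ θ) (hp : p ≤ θ * a) (ξ : E) (hN : ConvexOn ℝ Set.univ fun x => H x - a / 2 * ‖x‖ ^ 2) :
    ConvexOn ℝ Set.univ fun x => θ * (H (ξ + x) - d) - p / 2 * ‖x‖ ^ 2 := by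
  have h1 : ConvexOn ℝ Set.univ fun x : E => θ • (H (x + ξ) - a / 2 * ‖x + ξ‖ ^ 2) := by
    have := (hN.translate_left ξ).smul hθ
    simpa using this
  have h2 : ConvexOn ℝ Set.univ fun x : E => ((θ * a - p) / 2) • ‖x‖ ^ 2 :=
    ((convexOn_norm convex_univ).pow (fun x _ => norm_nonneg x) 2).smul (by linarith)
  have h3 : ConvexOn ℝ Set.univ fun x : E => ⟪(θ * a) • ξ, x⟫ :=
    (innerSL ℝ ((θ * a) • ξ)).toLinearMap.convexOn convex_univ
  have h4 := ((h1.add h2).add h3).add_const (θ * a / 2 * ‖ξ‖ ^ 2 - θ * d)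
  refine h4.congr ?_
  intro x _
  simp only [Pi.add_apply, smul_eq_mul, inner_smul_left, norm_add_sq_real, real_inner_comm x ξ, add_comm ξ x]
  simp
  ring

end reduction

/-- If `H : ℝ^{2n} → ℝ` is a `C²` convex function, `(a∞, b∞)`-subquadratic at infinity,
with a finite nonempty set of equilibria `{ξ₁, …, ξ_N}`, `ω` the minimum over `k` of the
smallest eigenvalue of `H''(ξ_k)`, and `(T/2π) b∞ < -E[-(T/2π) a∞] < (T/2π) ω`
(where `E[α] = ⌈α⌉ - 1`), then there exists a non-constant `C¹` `T`-periodic solution of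
`ẋ = J ∇H(x)`. -/
theorem nonconstant_periodic_solution_of_pinching
    (n : ℕ) (hn : 1 ≤ n) (T : ℝ) (hT : 0 < T)
    (a b : ℝ) (hab : a ≤ b)
    (H : EuclideanSpace ℝ (Fin (2*n)) → ℝ)
    (hH2 : ContDiff ℝ 2 H)
    (hHconv : ConvexOn ℝ Set.univ H)
    -- `(a∞, b∞)`-subquadraticity at infinity:
    (hNconv : ConvexOn ℝ Set.univ
      (fun x : EuclideanSpace ℝ (Fin (2*n)) => H x - a/2 * ‖x‖^2))
    (hgrowth : ∃ nf : ℝ → ℝ,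
      (∀ x : EuclideanSpace ℝ (Fin (2*n)), nf ‖x‖ ≤ H x - a/2 * ‖x‖^2) ∧
      Tendsto (fun s => nf s / s) atTop atTop)
    (hupper : ∃ c : ℝ, ∀ x : EuclideanSpace ℝ (Fin (2*n)), H x ≤ b/2 * ‖x‖^2 + c)
    -- the equilibria form a finite nonempty set `s`:
    (s : Finset (EuclideanSpace ℝ (Fin (2*n)))) (hs : s.Nonempty)
    (heq : ∀ ξ : EuclideanSpace ℝ (Fin (2*n)),
      gradient (F := EuclideanSpace ℝ (Fin (2*n))) H ξ = 0 ↔ ξ ∈ s)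
    -- `ωf ξ` is the smallest eigenvalue of the Hessian `H''(ξ)`, and `ω` is their minimum:
    (ωf : EuclideanSpace ℝ (Fin (2*n)) → ℝ)
    (hωf : ∀ ξ ∈ s, IsLeast
      {μ : ℝ | ∃ v : Fin (2*n) → ℝ, v ≠ 0 ∧ (hessianMatrix H ξ).mulVec v = μ • v} (ωf ξ))
    (ω : ℝ) (hω : ω = s.inf' hs ωf)
    -- the pinching condition `(T/2π) b∞ < -E[-(T/2π) a∞] < (T/2π) ω`:
    (hcond1 : T/(2*π) * b < -((⌈-(T/(2*π)) * a⌉ - 1 : ℤ) : ℝ))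
    (hcond2 : -((⌈-(T/(2*π)) * a⌉ - 1 : ℤ) : ℝ) < T/(2*π) * ω) :
    ∃ x : ℝ → EuclideanSpace ℝ (Fin (2*n)), ContDiff ℝ 1 x ∧
      (∀ t, x (t + T) = x t) ∧
      (∀ t, deriv x t =
        (symplecticJ n).mulVec (gradient (F := EuclideanSpace ℝ (Fin (2*n))) H (x t))) ∧
      ∃ t₁ t₂, x t₁ ≠ x t₂ := by
  classical
  obtain ⟨J, hJm, hJ2, hJs⟩ := aux_J_clm n
  have hpi := pi_pos
  obtain ⟨θ, hθ⟩ : ∃ θ : ℝ, θ = T / (2 * π) := ⟨_, rfl⟩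
  have hθ0 : 0 < θ := by rw [hθ]; positivity
  obtain ⟨k, hk⟩ : ∃ k : ℤ, k = -(⌈-θ * a⌉ - 1) := ⟨_, rfl⟩
  have hk1 : θ * b < k := by
    rw [hk, hθ]; push_cast; push_cast at hcond1; exact hcond1
  have hk2 : (k : ℝ) < θ * ω := by
    rw [hk, hθ]; push_cast; push_cast at hcond2; exact hcond2
  have hk3 : (k : ℝ) - 1 ≤ θ * a := by
    have := Int.le_ceil (-θ * a)
    rw [hk]; push_cast; linarith
  obtain ⟨ξ, hξ⟩ := hs
  have hωξ : ω ≤ ωf ξ := by rw [hω]; exact Finset.inf'_le _ hξ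
  have hd1 : Differentiable ℝ H := hH2.differentiable (by norm_num)
  have hgr : ∀ x, HasFDerivAt H (innerSL ℝ (gradient H x)) x := fun x =>
    (hd1 x).hasGradientAt.hasFDerivAt
  have hgξ : gradient H ξ = 0 := (heq ξ).mpr hξ
  have hfξ : fderiv ℝ H ξ = 0 := by rw [(hgr ξ).fderiv, hgξ, map_zero]
  have hHg : ∀ x y, H x + ⟪gradient H x, y - x⟫ ≤ H y := fun x y =>
    aux_gradient_ineq H hHconv x y _ (hgr x)
  have hgc : Continuous (gradient H) := by
    have : Continuous (fderiv ℝ H) := hH2.continuous_fderiv (by norm_num)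
    unfold gradient
    exact (LinearIsometryEquiv.continuous _).comp this
  -- the local lower bound
  obtain ⟨w', hw'1, hw'2⟩ : ∃ w', k / θ < w' ∧ w' < ω := exists_between (by rw [div_lt_iff₀ hθ0]; linarith)
  obtain ⟨r, hr, hloc⟩ := aux_local_lower H hH2 ξ hfξ ω w' hw'2 (by
    apply aux_hessian H hH2 ξ ω
    intro μ hμ
    exact hωξ.trans ((hωf ξ hξ).2 hμ))
  have hw'3 : (k : ℝ) < θ * w' := by rw [div_lt_iff₀ hθ0] at hw'1; linarith
  set F : EuclideanSpace ℝ (Fin (2*n)) → ℝ := fun x => θ * (H (ξ + x) - H ξ) with hF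
  set f : EuclideanSpace ℝ (Fin (2*n)) → EuclideanSpace ℝ (Fin (2*n)) := fun x => θ • gradient H (ξ + x) with hf
  have hFc : Continuous F := by
    have := hH2.continuous
    fun_prop
  have hfc : Continuous f := by fun_prop
  have hF0 : F 0 = 0 := by simp [hF]
  have hFn : ∀ x, 0 ≤ F x := by
    intro x
    have := hHg ξ (ξ + x)
    rw [hgξ, inner_zero_left, add_zero] at this
    exact mul_nonneg hθ0.le (by linarith)
  have hgrad : ∀ x y, F x + ⟪f x, y - x⟫ ≤ F y := by
    intro x y
    have h1 := hHg (ξ + x) (ξ + y)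
    rw [add_sub_add_left_eq_sub] at h1
    have h2 := mul_le_mul_of_nonneg_left h1 hθ0.le
    simp only [hF, hf, inner_smul_left, conj_trivial]
    linarith
  have hN : ConvexOn ℝ Set.univ fun x => F x - ((k : ℝ) - 1) / 2 * ‖x‖ ^ 2 :=
    aux_convex_shift H a θ ((k : ℝ) - 1) (H ξ) hθ0.le hk3 ξ hNconv
  have hFd : HasFDerivAt F (0 : EuclideanSpace ℝ (Fin (2*n)) →L[ℝ] ℝ) 0 := by
    have h1 : HasFDerivAt (fun x => H (ξ + x)) (0 : EuclideanSpace ℝ (Fin (2*n)) →L[ℝ] ℝ) 0 := by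
      rw [hasFDerivAt_comp_add_left, add_zero]
      have := hgr ξ
      rwa [hgξ, map_zero] at this
    have h2 := (h1.sub_const (H ξ)).const_mul θ
    rwa [smul_zero] at h2
  have hN0 : ∀ x, 0 ≤ F x - ((k : ℝ) - 1) / 2 * ‖x‖ ^ 2 := by
    intro x
    have h1 : HasFDerivAt (fun x : EuclideanSpace ℝ (Fin (2*n)) => ‖x‖ ^ 2)
        (0 : EuclideanSpace ℝ (Fin (2*n)) →L[ℝ] ℝ) 0 := by
      have := (hasStrictFDerivAt_norm_sq (0 : EuclideanSpace ℝ (Fin (2*n)))).hasFDerivAt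
      simpa using this
    have h2 := hFd.sub (h1.const_mul (((k : ℝ) - 1) / 2))
    rw [smul_zero, sub_zero] at h2
    have h3 := aux_gradient_ineq _ hN 0 x _ h2
    simpa [hF0] using h3
  obtain ⟨b', hb'1, hb'2⟩ := exists_between hk1
  obtain ⟨c, hc⟩ := hupper
  obtain ⟨c₀, hup⟩ : ∃ c₀, ∀ x, F x ≤ b' / 2 * ‖x‖ ^ 2 + c₀ := by
    set η := b' - θ * b with hη
    have hη0 : 0 < η := by linarith
    refine ⟨(θ * |b| * ‖ξ‖) ^ 2 / (2 * η) + θ * (b / 2 * ‖ξ‖ ^ 2 + c - H ξ), fun x => ?_⟩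
    have h1 := mul_le_mul_of_nonneg_left (hc (ξ + x)) hθ0.le
    rw [norm_add_sq_real] at h1
    have h2 : θ * (b * ⟪ξ, x⟫) ≤ θ * |b| * ‖ξ‖ * ‖x‖ := by
      have h3 : b * ⟪ξ, x⟫ ≤ |b| * (‖ξ‖ * ‖x‖) := by
        refine (le_abs_self _).trans ?_
        rw [abs_mul]
        gcongr
        exact abs_real_inner_le_norm _ _
      have := mul_le_mul_of_nonneg_left h3 hθ0.le
      linarith
    have h4 : θ * |b| * ‖ξ‖ * ‖x‖ ≤ η / 2 * ‖x‖ ^ 2 + (θ * |b| * ‖ξ‖) ^ 2 / (2 * η) := by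
      have h5 : η / 2 * ‖x‖ ^ 2 + (θ * |b| * ‖ξ‖) ^ 2 / (2 * η) - θ * |b| * ‖ξ‖ * ‖x‖
        = (η * ‖x‖ - θ * |b| * ‖ξ‖) ^ 2 / (2 * η) := by
        field_simp; ring
      have h6 : 0 ≤ (η * ‖x‖ - θ * |b| * ‖ξ‖) ^ 2 / (2 * η) := by positivity
      linarith
    have h7 : b' = η + θ * b := by rw [hη]; ring
    rw [h7]
    simp only [hF]
    linarith
  have hnt : Nontrivial (EuclideanSpace ℝ (Fin (2*n))) := by
    have : Nonempty (Fin (2*n)) := ⟨⟨0, by omega⟩⟩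
    infer_instance
  obtain ⟨y, hy1, hy2, t₁, t₂, hy3⟩ := aux_core J hJ2 hJs F f hFc hfc hgrad k b' c₀ (θ * w') r hb'2 hw'3 hr hN hN0
    hFn hF0 hup (by
      intro x hx
      have := mul_le_mul_of_nonneg_left (hloc x hx) hθ0.le
      simp only [hF]
      linarith)
  have hyc : Continuous y := continuous_iff_continuousAt.mpr fun t => (hy2 t).continuousAt
  have hxd : ∀ t, HasDerivAt (fun t => ξ + y (t / θ)) (J (gradient H (ξ + y (t / θ)))) t := by
    intro t
    have h1 : HasDerivAt (fun t : ℝ => t / θ) (1 / θ) t := (hasDerivAt_id t).div_const θ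
    have h2 := ((hy2 (t / θ)).scomp t h1).const_add ξ
    refine h2.congr_deriv ?_
    simp only [hf, map_smul, smul_smul]
    rw [one_div, inv_mul_cancel₀ hθ0.ne', one_smul]
  refine ⟨fun t => ξ + y (t / θ), ?_, ?_, ?_, θ * t₁, θ * t₂, ?_⟩
  · rw [contDiff_one_iff_deriv]
    refine ⟨fun t => (hxd t).differentiableAt, ?_⟩
    rw [funext fun t => (hxd t).deriv]
    fun_prop
  · intro t
    have : (t + T) / θ = t / θ + 2 * π := by
      rw [hθ]; field_simp
    simp only [this, hy1]
  · intro t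
    rw [(hxd t).deriv, hJm]
  · simp only [mul_div_cancel_left₀ _ hθ0.ne']
    intro h
    exact hy3 (add_left_cancel h)
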